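/- arXiv:0905.2639 — 2 statements merged into one kernel-verified Lean document; each statement's English description precedes it below -/
import Mathlib

section
/- Let p ≥ 2 and k ≥ 8 be integers, let λ > 0 and ω ≥ 1 be reals, let m be the largest integer with m(m−1)/2 ≤ k+1, and assume p ≥ m, λ·m ≤ ω, and λ ≤ ω. If the sample size n satisfies n ≤ max{ (log p)/(2 λ tanh λ), exp(ω/2) · log(k/8) / (64 ω exp(5λ/2) sinh λ) }, then for every graph decoder φ : ({−1,+1}^p)^n → G_{p,k} there is some graph G ∈ G_{p,k} and parameter vector θ ∈ Θ_{λ,ω}(G) such that the probability, under n i.i.d. samples X_1,…,X_n from the Ising model P_θ, that φ(X_1,…,X_n) ≠ G is at least 1/2. -/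
open scoped Classical BigOperators
open Real

noncomputable section

/-- Sign of a Boolean spin: `true ↦ 1`, `false ↦ -1`. -/
def sgn (b : Bool) : ℝ := if b then 1 else -1

/-- Ising energy `Σ_{s<t} θ_{st} x_s x_t`. -/
def energy {p : ℕ} (θ : Fin p → Fin p → ℝ) (x : Fin p → Bool) : ℝ :=
  ∑ s : Fin p, ∑ t : Fin p, if s < t then θ s t * sgn (x s) * sgn (x t) else 0

/-- Partition function `Z(θ)`. -/
def Zpart {p : ℕ} (θ : Fin p → Fin p → ℝ) : ℝ :=
  ∑ x : Fin p → Bool, Real.exp (energy θ x)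

/-- Ising probability mass function `P_θ`. -/
def isingP {p : ℕ} (θ : Fin p → Fin p → ℝ) (x : Fin p → Bool) : ℝ :=
  Real.exp (energy θ x) / Zpart θ

/-- Probability of an event under `n` i.i.d. samples from `P_θ`. -/
def probn {p : ℕ} (n : ℕ) (θ : Fin p → Fin p → ℝ)
    (A : (Fin n → Fin p → Bool) → Prop) : ℝ :=
  ∑ xs : Fin n → Fin p → Bool, if A xs then ∏ i, isingP θ (xs i) else 0

/-- Probability of a single-sample event under `P_θ`. -/
def prob1 {p : ℕ} (θ : Fin p → Fin p → ℝ) (A : (Fin p → Bool) → Prop) : ℝ :=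
  ∑ x : Fin p → Bool, if A x then isingP θ x else 0

/-- A parameter vector: symmetric array vanishing on the diagonal. -/
def IsSymParam {p : ℕ} (θ : Fin p → Fin p → ℝ) : Prop :=
  (∀ s t, θ s t = θ t s) ∧ (∀ s, θ s s = 0)

/-- The class `Θ_{λ,ω}(G)` of admissible parameter vectors for graph `G`. -/
def ParamClass {p : ℕ} (G : SimpleGraph (Fin p)) (lam om : ℝ)
    (θ : Fin p → Fin p → ℝ) : Prop :=
  IsSymParam θ ∧ (∀ s t : Fin p, ¬ G.Adj s t → θ s t = 0) ∧
    (∀ s t : Fin p, G.Adj s t → lam ≤ |θ s t|) ∧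
    (∀ s : Fin p, (∑ t : Fin p, |θ s t|) ≤ om)

/-- The class `G_{p,d}` of graphs with maximum degree at most `d`. -/
def degClass (p d : ℕ) : Set (SimpleGraph (Fin p)) :=
  {G | ∀ v : Fin p, ({u | G.Adj v u}).ncard ≤ d}

/-- The class `G_{p,k}` of graphs with at most `k` edges. -/
def edgeClass (p k : ℕ) : Set (SimpleGraph (Fin p)) :=
  {G | G.edgeSet.ncard ≤ k}

/-- Kullback–Leibler divergence `D(θ‖θ')` between Ising models. -/
def KLdiv {p : ℕ} (θ θ' : Fin p → Fin p → ℝ) : ℝ :=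
  ∑ x : Fin p → Bool, isingP θ x * Real.log (isingP θ x / isingP θ' x)

/-- Symmetrized KL divergence `S(θ‖θ')`. -/
def symKL {p : ℕ} (θ θ' : Fin p → Fin p → ℝ) : ℝ := KLdiv θ θ' + KLdiv θ' θ

/-- The divergence `J(θ‖θ') = D((θ+θ')/2‖θ) + D((θ+θ')/2‖θ')`. -/
def Jdiv {p : ℕ} (θ θ' : Fin p → Fin p → ℝ) : ℝ :=
  KLdiv (fun s t => (θ s t + θ' s t) / 2) θ +
    KLdiv (fun s t => (θ s t + θ' s t) / 2) θ'

/-- Mean parameter `μ_{st}(θ) = E_θ[X_s X_t]`. -/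
def meanPar {p : ℕ} (θ : Fin p → Fin p → ℝ) (s t : Fin p) : ℝ :=
  ∑ x : Fin p → Bool, isingP θ x * (sgn (x s) * sgn (x t))


lemma sgn_mul_eq (b c : Bool) : sgn b * sgn c = if b ≠ c then -1 else 1 := by
  cases b <;> cases c <;> simp [sgn]

lemma sgn_not (b : Bool) : sgn (!b) = -sgn b := by cases b <;> simp [sgn]

lemma Zpart_pos {p : ℕ} (θ : Fin p → Fin p → ℝ) : 0 < Zpart θ :=
  Finset.sum_pos (fun _ _ => Real.exp_pos _) Finset.univ_nonempty

lemma isingP_pos {p : ℕ} (θ : Fin p → Fin p → ℝ) (x : Fin p → Bool) : 0 < isingP θ x :=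
  div_pos (Real.exp_pos _) (Zpart_pos θ)

lemma sum_isingP {p : ℕ} (θ : Fin p → Fin p → ℝ) : ∑ x, isingP θ x = 1 := by
  unfold isingP
  rw [← Finset.sum_div]
  exact div_self (Zpart_pos θ).ne'

lemma prob1_nonneg {p : ℕ} (θ : Fin p → Fin p → ℝ) (A : (Fin p → Bool) → Prop) :
    0 ≤ prob1 θ A :=
  Finset.sum_nonneg fun x _ => by
    split_ifs
    exacts [(isingP_pos θ x).le, le_rfl]

lemma prob1_le_one {p : ℕ} (θ : Fin p → Fin p → ℝ) (A : (Fin p → Bool) → Prop) :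
    prob1 θ A ≤ 1 := by
  rw [← sum_isingP θ]
  refine Finset.sum_le_sum fun x _ => ?_
  split_ifs
  exacts [le_rfl, (isingP_pos θ x).le]

lemma prob1_add_prob1_not {p : ℕ} (θ : Fin p → Fin p → ℝ) (A : (Fin p → Bool) → Prop) :
    prob1 θ A + prob1 θ (fun x => ¬ A x) = 1 := by
  rw [← sum_isingP θ, prob1, prob1, ← Finset.sum_add_distrib]
  refine Finset.sum_congr rfl fun x _ => ?_
  by_cases h : A x <;> simp [h]

lemma prob1_le_add {p : ℕ} (θ : Fin p → Fin p → ℝ) (A B C : (Fin p → Bool) → Prop)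
    (h : ∀ x, A x → B x ∨ C x) : prob1 θ A ≤ prob1 θ B + prob1 θ C := by
  rw [prob1, prob1, prob1, ← Finset.sum_add_distrib]
  refine Finset.sum_le_sum fun x _ => ?_
  have hx := (isingP_pos θ x).le
  have := h x
  by_cases hA : A x <;> by_cases hB : B x <;> by_cases hC : C x <;> simp_all

/-- Negate the spins in `S`. -/
def flipOn {p : ℕ} (S : Fin p → Prop) (x : Fin p → Bool) : Fin p → Bool :=
  fun i => if S i then !x i else x i

lemma flipOn_involutive {p : ℕ} (S : Fin p → Prop) : Function.Involutive (flipOn S) := by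
  intro x
  funext i
  by_cases h : S i <;> simp [flipOn, h]

/-- Add a coupling of strength `lam` between `a` and `b`. -/
def addCoupling {p : ℕ} (θ : Fin p → Fin p → ℝ) (lam : ℝ) (a b : Fin p) :
    Fin p → Fin p → ℝ :=
  fun s t => θ s t + if (s = a ∧ t = b) ∨ (s = b ∧ t = a) then lam else 0

lemma energy_addCoupling {p : ℕ} (θ : Fin p → Fin p → ℝ) (lam : ℝ) {a b : Fin p} (hab : a < b)
    (x : Fin p → Bool) :
    energy (addCoupling θ lam a b) x = energy θ x + lam * (sgn (x a) * sgn (x b)) := by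
  have key : ∀ s t : Fin p,
      (if s < t then addCoupling θ lam a b s t * sgn (x s) * sgn (x t) else 0) =
        (if s < t then θ s t * sgn (x s) * sgn (x t) else 0) +
          if s = a then (if t = b then lam * (sgn (x a) * sgn (x b)) else 0) else 0 := by
    intro s t
    unfold addCoupling
    by_cases h1 : s = a
    · subst h1
      by_cases h2 : t = b
      · subst h2
        simp [hab]
        ring
      · have : s ≠ b := hab.ne
        simp [h2, this]
    · by_cases h2 : s = b
      · subst h2
        by_cases h3 : t = a
        · subst h3
          simp [hab.not_gt, h1]
        · simp [h3, h1]
      · simp [h1, h2]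
  simp only [energy, key, Finset.sum_add_distrib]
  simp

/-- The second moment of the likelihood ratio for one added coupling, in terms of the
probability that the two spins disagree under the base model. -/
lemma sum_sq_div_addCoupling {p : ℕ} (θ : Fin p → Fin p → ℝ) (lam : ℝ) {a b : Fin p}
    (hab : a < b) (q : ℝ) (hq : q = prob1 θ (fun x => x a ≠ x b)) :
    ∑ x, isingP (addCoupling θ lam a b) x ^ 2 / isingP θ x =
      1 + q * (1 - q) * (2 * Real.sinh lam) ^ 2 /
        (Real.exp lam - 2 * q * Real.sinh lam) ^ 2 := by
  have hZ := Zpart_pos θ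
  have expect : ∀ c : ℝ, ∑ x, Real.exp (energy θ x) * Real.exp (c * (sgn (x a) * sgn (x b))) =
      Zpart θ * (Real.exp c * (1 - q) + Real.exp (-c) * q) := by
    intro c
    have h1 : ∀ x : Fin p → Bool,
        Real.exp (energy θ x) * Real.exp (c * (sgn (x a) * sgn (x b))) =
        Zpart θ * (Real.exp c * isingP θ x +
          (Real.exp (-c) - Real.exp c) * if x a ≠ x b then isingP θ x else 0) := by
      intro x
      rw [sgn_mul_eq]
      have : Real.exp (energy θ x) = Zpart θ * isingP θ x := by
        unfold isingP
        field_simp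
      rw [this]
      split_ifs
      · simp only [mul_neg, mul_one]
        ring
      · simp only [mul_one, mul_zero, add_zero]
        ring
    have hdis : (∑ x, if x a ≠ x b then isingP θ x else 0) = q := by
      rw [hq, prob1]
      congr!
    rw [Finset.sum_congr rfl fun x _ => h1 x, ← Finset.mul_sum, Finset.sum_add_distrib,
      ← Finset.mul_sum, ← Finset.mul_sum, sum_isingP, hdis]
    ring
  have hZ' : Zpart (addCoupling θ lam a b) =
      Zpart θ * (Real.exp lam * (1 - q) + Real.exp (-lam) * q) := by
    rw [← expect, Zpart]
    simp only [energy_addCoupling θ lam hab, Real.exp_add]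
  have hpos : 0 < Real.exp lam * (1 - q) + Real.exp (-lam) * q := by
    have := Zpart_pos (addCoupling θ lam a b)
    rw [hZ'] at this
    exact pos_of_mul_pos_right this hZ.le
  have hterm : ∀ x, isingP (addCoupling θ lam a b) x ^ 2 / isingP θ x =
      Real.exp (energy θ x) * Real.exp (2 * lam * (sgn (x a) * sgn (x b))) *
        (Zpart θ / Zpart (addCoupling θ lam a b) ^ 2) := by
    intro x
    unfold isingP
    rw [energy_addCoupling θ lam hab, mul_assoc 2 lam, two_mul, Real.exp_add, Real.exp_add]
    have := Real.exp_pos (energy θ x)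
    have := Zpart_pos (addCoupling θ lam a b)
    field_simp
  rw [Finset.sum_congr rfl fun x _ => hterm x, ← Finset.sum_mul, expect, hZ']
  have hden : Real.exp lam - 2 * q * Real.sinh lam =
      Real.exp lam * (1 - q) + Real.exp (-lam) * q := by
    rw [Real.sinh_eq]; ring
  rw [hden, Real.sinh_eq]
  have e2 : Real.exp (2 * lam) = Real.exp lam ^ 2 := by rw [← Real.exp_nat_mul]; simp
  have e3 : Real.exp (-(2 * lam)) = Real.exp (-lam) ^ 2 := by
    rw [← Real.exp_nat_mul]; congr 1; push_cast; ring
  rw [e2, e3]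
  generalize Real.exp lam = u at *
  generalize Real.exp (-lam) = v at *
  have hW : (u * (1 - q) + v * q) ^ 2 ≠ 0 := by positivity
  have hcancel : Zpart θ * (u ^ 2 * (1 - q) + v ^ 2 * q) *
      (Zpart θ / (Zpart θ * (u * (1 - q) + v * q)) ^ 2) =
      (u ^ 2 * (1 - q) + v ^ 2 * q) / (u * (1 - q) + v * q) ^ 2 := by
    rw [mul_pow]
    field_simp
  rw [hcancel, div_eq_iff hW, add_mul, div_mul_cancel₀ _ hW]
  ring

/-- If every likelihood ratio against the base law has second moment at most `1 + χ`, no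
decoder identifies all of the laws with probability exceeding `1 / 2`. -/
lemma exists_half_le_error {Ω Γ ι : Type*} [Fintype Ω] [Fintype ι]
    (P : Option ι → Ω → ℝ) (hpos : ∀ x, 0 < P none x) (hsum : ∀ j, ∑ x, P j x = 1)
    (χ : ℝ) (hχ : ∀ j : ι, ∑ x, P (some j) x ^ 2 / P none x ≤ 1 + χ)
    (hN : 2 ≤ Fintype.card ι)
    (hNχ : 4 * (Fintype.card ι : ℝ) * χ ≤ ((Fintype.card ι : ℝ) - 1) ^ 2)
    (G : Option ι → Γ) (hG : Function.Injective G) (φ : Ω → Γ) :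
    ∃ j, 1 / 2 ≤ ∑ x, if φ x ≠ G j then P j x else 0 := by
  by_contra! hcon
  set N : ℝ := (Fintype.card ι : ℝ) with hNdef
  have hN' : (2 : ℝ) ≤ N := by rw [hNdef]; exact_mod_cast hN
  set t : ℝ := (N - 1) / 2 with ht
  have htpos : 0 < t := by rw [ht]; linarith
  have hsucc : ∀ j, 1 / 2 < ∑ x, if φ x = G j then P j x else 0 := by
    intro j
    have h1 : (∑ x, if φ x = G j then P j x else 0) +
        (∑ x, if φ x ≠ G j then P j x else 0) = 1 := by
      rw [← hsum j, ← Finset.sum_add_distrib]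
      refine Finset.sum_congr rfl fun x _ => ?_
      by_cases h : φ x = G j <;> simp [h]
    linarith [hcon j]
  have hlow : (N + 1) / 2 < ∑ j, ∑ x, if φ x = G j then P j x else 0 := by
    calc (N + 1) / 2 = ∑ _j : Option ι, (1 / 2 : ℝ) := by
          simp [hNdef]; ring
      _ < _ := Finset.sum_lt_sum_of_nonempty Finset.univ_nonempty fun j _ => hsucc j
  have hterm : ∀ (j : ι) x, (if φ x = G (some j) then P (some j) x else 0) ≤
      (1 + t / 2) * (if φ x = G (some j) then P none x else 0) +
        (P (some j) x ^ 2 / P none x - 2 * P (some j) x + P none x) / (2 * t) := by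
    intro j x
    have hq := hpos x
    have hsq : P (some j) x ^ 2 / P none x - 2 * P (some j) x + P none x =
        (P (some j) x - P none x) ^ 2 / P none x := by
      field_simp
      ring
    rw [hsq]
    split_ifs
    · rw [← sub_nonneg]
      have : (1 + t / 2) * P none x +
          (P (some j) x - P none x) ^ 2 / P none x / (2 * t) - P (some j) x =
          (t * P none x - (P (some j) x - P none x)) ^ 2 / (2 * t * P none x) := by
        field_simp
        ring
      rw [this]
      positivity
    · simp only [mul_zero, zero_add]
      positivity
  have hmass : (∑ x, if φ x = G none then P none x else 0) +
      ∑ j : ι, ∑ x, (if φ x = G (some j) then P none x else 0) ≤ 1 := by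
    have h1 : ∑ j : Option ι, ∑ x, (if φ x = G j then P none x else 0) ≤ 1 := by
      rw [Finset.sum_comm, ← hsum none]
      refine Finset.sum_le_sum fun x _ => ?_
      by_cases h : ∃ j, φ x = G j
      · obtain ⟨j, hj⟩ := h
        rw [hj]
        simp [hG.eq_iff]
      · push Not at h
        simp [h, (hpos x).le]
    rwa [Fintype.sum_option] at h1
  rw [Fintype.sum_option] at hlow
  have hS0 : 0 ≤ ∑ x, if φ x = G none then P none x else 0 :=
    Finset.sum_nonneg fun x _ => by split_ifs; exacts [(hpos x).le, le_rfl]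
  have hup : ∑ j : ι, ∑ x, (if φ x = G (some j) then P (some j) x else 0) ≤
      (1 + t / 2) * (∑ j : ι, ∑ x, (if φ x = G (some j) then P none x else 0)) +
        N * (χ / (2 * t)) := by
    calc _ ≤ ∑ j : ι, ((1 + t / 2) * (∑ x, (if φ x = G (some j) then P none x else 0)) +
          χ / (2 * t)) := by
          refine Finset.sum_le_sum fun j _ => ?_
          refine (Finset.sum_le_sum fun x _ => hterm j x).trans ?_
          rw [Finset.sum_add_distrib, ← Finset.mul_sum, ← Finset.sum_div,
            Finset.sum_add_distrib, Finset.sum_sub_distrib, ← Finset.mul_sum, hsum, hsum]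
          gcongr
          linarith [hχ j]
      _ = _ := by
          rw [Finset.sum_add_distrib, ← Finset.mul_sum]
          simp [hNdef]
  have h2 : N * (χ / (2 * t)) ≤ t / 2 := by
    rw [← mul_div_assoc, div_le_div_iff₀ (by positivity) (by norm_num)]
    nlinarith
  nlinarith

lemma isingP_iid_sum {p : ℕ} (n : ℕ) (θ : Fin p → Fin p → ℝ) :
    ∑ xs : Fin n → Fin p → Bool, ∏ i, isingP θ (xs i) = 1 := by
  rw [← Fintype.sum_pow, sum_isingP, one_pow]

lemma isingP_iid_sum_sq_div {p : ℕ} (n : ℕ) (θ θ' : Fin p → Fin p → ℝ) :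
    ∑ xs : Fin n → Fin p → Bool, (∏ i, isingP θ (xs i)) ^ 2 / ∏ i, isingP θ' (xs i) =
      (∑ x, isingP θ x ^ 2 / isingP θ' x) ^ n := by
  rw [Fintype.sum_pow]
  simp [Finset.prod_div_distrib, Finset.prod_pow]

lemma paramClass_addCoupling {p : ℕ} {G : SimpleGraph (Fin p)} {lam om : ℝ}
    {θ : Fin p → Fin p → ℝ} (hlam : 0 < lam) (hθ : ParamClass G lam om θ)
    (hrow : ∀ s, (∑ t, |θ s t|) + lam ≤ om) {a b : Fin p} (hab : a < b) (hadj : ¬ G.Adj a b) :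
    ParamClass (G ⊔ SimpleGraph.edge a b) lam om (addCoupling θ lam a b) := by
  obtain ⟨⟨hs, hd⟩, h0, h1, -⟩ := hθ
  have hne := hab.ne
  refine ⟨⟨fun s t => ?_, fun s => ?_⟩, fun s t h => ?_, fun s t h => ?_, fun s => ?_⟩
  · unfold addCoupling
    rw [hs s t]
    congr 2
    apply propext
    tauto
  · unfold addCoupling
    rw [hd, if_neg]
    · simp
    · rintro (⟨rfl, rfl⟩ | ⟨rfl, rfl⟩) <;> exact hne rfl
  · rw [SimpleGraph.sup_adj, SimpleGraph.edge_adj] at h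
    push Not at h
    unfold addCoupling
    rw [h0 s t h.1, if_neg, add_zero]
    intro hst
    have : s ≠ t := by rintro rfl; rcases hst with ⟨rfl, rfl⟩ | ⟨rfl, rfl⟩ <;> exact hne rfl
    have := h.2
    tauto
  · unfold addCoupling
    by_cases hst : (s = a ∧ t = b) ∨ (s = b ∧ t = a)
    · have : ¬ G.Adj s t := by
        rcases hst with ⟨rfl, rfl⟩ | ⟨rfl, rfl⟩
        exacts [hadj, fun h => hadj h.symm]
      rw [if_pos hst, h0 s t this, zero_add]
      exact le_abs_self _
    · rw [if_neg hst, add_zero]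
      rw [SimpleGraph.sup_adj, SimpleGraph.edge_adj] at h
      exact h1 s t (h.resolve_right fun h => hst (by tauto))
  · refine le_trans ?_ (hrow s)
    calc ∑ t, |addCoupling θ lam a b s t| ≤
        ∑ t, (|θ s t| + if t = (if s = a then b else a) then lam else 0) := by
          refine Finset.sum_le_sum fun t _ => (abs_add_le _ _).trans ?_
          gcongr
          by_cases hst : (s = a ∧ t = b) ∨ (s = b ∧ t = a)
          · rw [if_pos hst, if_pos, abs_of_pos hlam]
            rcases hst with ⟨rfl, rfl⟩ | ⟨rfl, rfl⟩
            · simp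
            · simp [hne.symm]
          · rw [if_neg hst, abs_zero]
            split_ifs <;> simp [hlam.le]
      _ = _ := by
          rw [Finset.sum_add_distrib]
          simp

/-- A decoder cannot reliably tell which of the candidate couplings has been added to a base
model, provided every candidate pair has a small likelihood-ratio second moment. -/
lemma exists_half_le_probn {p n k : ℕ} {lam om χ : ℝ} {ι : Type} [Fintype ι]
    (hlam : 0 < lam) (G : SimpleGraph (Fin p)) (hcard : G.edgeSet.ncard + 1 ≤ k)
    (θ : Fin p → Fin p → ℝ) (hθ : ParamClass G lam om θ)
    (hrow : ∀ s, (∑ t, |θ s t|) + lam ≤ om)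
    (a b : ι → Fin p) (hab : ∀ j, a j < b j) (hadj : ∀ j, ¬ G.Adj (a j) (b j))
    (hinj : ∀ i j, a i = a j → b i = b j → i = j)
    (hχ : ∀ j, (∑ x, isingP (addCoupling θ lam (a j) (b j)) x ^ 2 / isingP θ x) ^ n ≤ 1 + χ)
    (hN : 2 ≤ Fintype.card ι)
    (hNχ : 4 * (Fintype.card ι : ℝ) * χ ≤ ((Fintype.card ι : ℝ) - 1) ^ 2)
    (φ : (Fin n → Fin p → Bool) → SimpleGraph (Fin p)) :
    ∃ G ∈ edgeClass p k, ∃ θ : Fin p → Fin p → ℝ, ParamClass G lam om θ ∧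
      (1 : ℝ) / 2 ≤ probn n θ (fun xs => φ xs ≠ G) := by
  let Θ : Option ι → Fin p → Fin p → ℝ := fun o =>
    o.elim θ fun j => addCoupling θ lam (a j) (b j)
  let Γ : Option ι → SimpleGraph (Fin p) := fun o =>
    o.elim G fun j => G ⊔ SimpleGraph.edge (a j) (b j)
  have hedge : ∀ j, (G ⊔ SimpleGraph.edge (a j) (b j)).Adj (a j) (b j) := fun j => by
    simp [SimpleGraph.edge_adj, (hab j).ne]
  have hΓ : Function.Injective Γ := by
    rintro (_ | i) (_ | j) h
    · rfl
    · exact absurd (show G.Adj (a j) (b j) from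
        (show G = G ⊔ SimpleGraph.edge (a j) (b j) from h) ▸ hedge j) (hadj j)
    · exact absurd (show G.Adj (a i) (b i) from
        (show G ⊔ SimpleGraph.edge (a i) (b i) = G from h) ▸ hedge i) (hadj i)
    · have h' : G ⊔ SimpleGraph.edge (a i) (b i) = G ⊔ SimpleGraph.edge (a j) (b j) := h
      have h1 := hedge i
      rw [h', SimpleGraph.sup_adj, SimpleGraph.edge_adj] at h1
      rcases h1.resolve_left (hadj i) with ⟨⟨h2, h3⟩ | ⟨h2, h3⟩, -⟩
      · rw [hinj i j h2 h3]
      · have h4 := hab i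
        rw [h2, h3] at h4
        exact absurd h4 (hab j).not_gt
  obtain ⟨j, hj⟩ := exists_half_le_error
    (fun o (xs : Fin n → Fin p → Bool) => ∏ i, isingP (Θ o) (xs i))
    (fun xs => Finset.prod_pos fun i _ => isingP_pos _ _)
    (fun o => isingP_iid_sum n (Θ o)) χ
    (fun j => (isingP_iid_sum_sq_div n _ _).trans_le (hχ j)) hN hNχ Γ hΓ φ
  refine ⟨Γ j, ?_, Θ j, ?_, by unfold probn; convert hj⟩
  · rcases j with _ | j
    · exact (Nat.le_succ _).trans hcard
    · refine le_trans ?_ hcard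
      change (G ⊔ SimpleGraph.edge (a j) (b j)).edgeSet.ncard ≤ _
      rw [SimpleGraph.edgeSet_sup]
      refine (Set.ncard_union_le _ _).trans ?_
      gcongr
      refine (Set.ncard_le_ncard (t := {s(a j, b j)}) ?_ (Set.finite_singleton _)).trans
        (Set.ncard_singleton _).le
      exact SimpleGraph.edgeSet_fromEdgeSet _ ▸ Set.sdiff_subset
  · rcases j with _ | j
    · exact hθ
    · exact paramClass_addCoupling hlam hθ hrow (hab j) (hadj j)

lemma prob1_ne_zero_param {p : ℕ} {a b : Fin p} (hab : a ≠ b) :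
    prob1 (0 : Fin p → Fin p → ℝ) (fun x => x a ≠ x b) = 1 / 2 := by
  have hswap : prob1 (0 : Fin p → Fin p → ℝ) (fun x => ¬ x a ≠ x b) =
      prob1 (0 : Fin p → Fin p → ℝ) (fun x => x a ≠ x b) := by
    unfold prob1
    refine Fintype.sum_equiv (flipOn_involutive (fun i => i = a)).toPerm _ _ fun x => ?_
    have h1 : (flipOn (fun i => i = a) x a ≠ flipOn (fun i => i = a) x b) ↔ ¬ x a ≠ x b := by
      simp only [flipOn, if_neg hab.symm, if_true]
      cases x a <;> cases x b <;> simp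
    have h2 : ∀ y, isingP (0 : Fin p → Fin p → ℝ) y = 1 / Zpart (0 : Fin p → Fin p → ℝ) := by
      intro y
      simp [isingP, energy]
    simp only [Function.Involutive.coe_toPerm, h1, h2]
  have := prob1_add_prob1_not (0 : Fin p → Fin p → ℝ) (fun x => x a ≠ x b)
  linarith

/-- The path on the first `m` vertices. -/
def initialPath (p m : ℕ) : SimpleGraph (Fin p) where
  Adj s t := (t.val = s.val + 1 ∧ t.val < m) ∨ (s.val = t.val + 1 ∧ s.val < m)
  symm := ⟨fun _ _ h => h.symm⟩
  loopless := ⟨fun s h => by omega⟩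

/-- Constant coupling `w` along the path on the first `m` vertices. -/
def pathParam (p m : ℕ) (w : ℝ) : Fin p → Fin p → ℝ :=
  fun s t => if (initialPath p m).Adj s t then w else 0

lemma energy_pathParam_flipOn {p m : ℕ} (w : ℝ) {i j : Fin p} (hij : j.val = i.val + 1)
    (hj : j.val < m) (x : Fin p → Bool) (hx : x i ≠ x j) :
    energy (pathParam p m w) (flipOn (fun s => s ≤ i) x) =
      energy (pathParam p m w) x + 2 * w := by
  have key : ∀ s t : Fin p,
      (if s < t then pathParam p m w s t * sgn (flipOn (fun s => s ≤ i) x s) *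
        sgn (flipOn (fun s => s ≤ i) x t) else 0) =
        (if s < t then pathParam p m w s t * sgn (x s) * sgn (x t) else 0) +
          if s = i then (if t = j then 2 * w else 0) else 0 := by
    intro s t
    by_cases hst : s < t
    swap
    · rw [if_neg hst, if_neg hst]
      split_ifs with h1 h2
      · subst h1 h2
        exact absurd (Fin.lt_def.2 (by omega)) hst
      all_goals simp
    rw [if_pos hst, if_pos hst]
    by_cases hadj : (initialPath p m).Adj s t
    swap
    · rw [pathParam, if_neg hadj]
      split_ifs with h1 h2
      · subst h1 h2
        exact absurd (Or.inl ⟨hij, hj⟩) hadj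
      all_goals simp
    rw [pathParam, if_pos hadj]
    have hts : t.val = s.val + 1 := by
      have := Fin.lt_def.1 hst
      rcases hadj with h | h <;> omega
    by_cases hsi : s = i
    · subst hsi
      have htj : t = j := Fin.ext (by omega)
      subst htj
      have h1 : ¬ t ≤ s := not_le.2 hst
      have h2 := sgn_mul_eq (x s) (x t)
      rw [if_pos hx] at h2
      simp only [flipOn, le_refl, if_true, if_neg h1, sgn_not]
      linear_combination -2 * w * h2
    · rw [if_neg hsi, add_zero]
      have hne : s.val ≠ i.val := fun h => hsi (Fin.ext h)
      by_cases h1 : s ≤ i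
      · have h2 : t ≤ i := by rw [Fin.le_def] at h1 ⊢; omega
        simp only [flipOn, if_pos h1, if_pos h2, sgn_not]
        ring
      · have h2 : ¬ t ≤ i := by rw [Fin.le_def] at h1 ⊢; omega
        simp only [flipOn, if_neg h1, if_neg h2]
  simp only [energy, key, Finset.sum_add_distrib]
  simp

lemma prob1_pathParam_succ_le {p m : ℕ} (w : ℝ) {i j : Fin p} (hij : j.val = i.val + 1)
    (hj : j.val < m) :
    prob1 (pathParam p m w) (fun x => x i ≠ x j) ≤ Real.exp (-(2 * w)) := by
  calc prob1 (pathParam p m w) (fun x => x i ≠ x j)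
      ≤ ∑ x, Real.exp (-(2 * w)) * isingP (pathParam p m w) (flipOn (fun s => s ≤ i) x) := by
        refine Finset.sum_le_sum fun x _ => ?_
        split_ifs with hx
        · unfold isingP
          rw [energy_pathParam_flipOn w hij hj x hx, ← mul_div_assoc, ← Real.exp_add]
          apply le_of_eq
          congr 2
          ring
        · have := isingP_pos (pathParam p m w) (flipOn (fun s => s ≤ i) x)
          positivity
    _ = Real.exp (-(2 * w)) := by
        have := Equiv.sum_comp (flipOn_involutive (fun s => s ≤ i)).toPerm
          (isingP (pathParam p m w))
        simp only [Function.Involutive.coe_toPerm] at this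
        rw [← Finset.mul_sum, this, sum_isingP, mul_one]

lemma sum_abs_pathParam_le {p m : ℕ} {w : ℝ} (hw : 0 ≤ w) (s : Fin p) :
    ∑ t, |pathParam p m w s t| ≤ 2 * w := by
  have hone : ∀ (P : Fin p → Prop) [DecidablePred P], (∀ t t', P t → P t' → t = t') →
      ∑ t, (if P t then w else 0) ≤ w := by
    intro P _ hP
    rw [← Finset.sum_filter, Finset.sum_const, nsmul_eq_mul]
    have : ((Finset.univ.filter P).card : ℝ) ≤ 1 := by
      exact_mod_cast Finset.card_le_one.2 fun t ht t' ht' =>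
        hP t t' (Finset.mem_filter.1 ht).2 (Finset.mem_filter.1 ht').2
    nlinarith
  calc ∑ t, |pathParam p m w s t|
      ≤ ∑ t : Fin p, ((if t.val = s.val + 1 then w else 0) +
          if s.val = t.val + 1 then w else 0) := by
        refine Finset.sum_le_sum fun t _ => ?_
        unfold pathParam initialPath
        simp only
        split_ifs <;> simp [abs_of_nonneg hw, hw] <;> omega
    _ ≤ 2 * w := by
        rw [Finset.sum_add_distrib, two_mul]
        refine add_le_add ?_ ?_
        · exact hone (fun t => t.val = s.val + 1) fun t t' h h' => Fin.ext (h.trans h'.symm)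
        · exact hone (fun t => s.val = t.val + 1) fun t t' h h' =>
            Fin.ext (Nat.succ_injective (h.symm.trans h'))

lemma ncard_edgeSet_initialPath_le (p m : ℕ) :
    (initialPath p m).edgeSet.ncard ≤ m - 1 := by
  have hsub : (initialPath p m).edgeSet ⊆
      (fun e : Sym2 (Fin p) => e.map Fin.val) ⁻¹'
        ((fun i : ℕ => s(i, i + 1)) '' (Finset.range (m - 1) : Set ℕ)) := by
    intro e
    induction e using Sym2.ind with
    | _ s t =>
      intro h
      rw [SimpleGraph.mem_edgeSet] at h
      simp only [Set.mem_preimage, Sym2.map_mk, Set.mem_image, Finset.coe_range, Set.mem_Iio]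
      rcases h with ⟨h1, h2⟩ | ⟨h1, h2⟩
      · exact ⟨s.val, by omega, by rw [h1]⟩
      · exact ⟨t.val, by omega, by rw [h1, Sym2.eq_swap]⟩
  have hinj : Function.Injective (fun e : Sym2 (Fin p) => e.map Fin.val) :=
    Sym2.map.injective Fin.val_injective
  calc (initialPath p m).edgeSet.ncard
      = ((fun e : Sym2 (Fin p) => e.map Fin.val) '' (initialPath p m).edgeSet).ncard :=
        (Set.ncard_image_of_injective _ hinj).symm
    _ ≤ ((fun i : ℕ => s(i, i + 1)) '' (Finset.range (m - 1) : Set ℕ)).ncard :=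
        Set.ncard_le_ncard (Set.image_subset_iff.2 hsub) ((Finset.finite_toSet _).image _)
    _ ≤ (Finset.range (m - 1) : Set ℕ).ncard := Set.ncard_image_le (Finset.finite_toSet _)
    _ = m - 1 := by rw [Set.ncard_coe_finset, Finset.card_range]

lemma paramClass_pathParam {p m : ℕ} {w lam om : ℝ} (hlam : 0 < lam) (hw : lam ≤ w)
    (hom : 2 * w ≤ om) : ParamClass (initialPath p m) lam om (pathParam p m w) := by
  refine ⟨⟨fun s t => ?_, fun s => ?_⟩, fun s t h => ?_, fun s t h => ?_, fun s => ?_⟩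
  · simp only [pathParam, (initialPath p m).adj_comm s t]
  · simp [pathParam]
  · simp [pathParam, h]
  · simpa [pathParam, h] using hw.trans (le_abs_self w)
  · exact (sum_abs_pathParam_le (hlam.le.trans hw) s).trans hom

lemma sinh_le_self_mul_cosh {x : ℝ} (hx : 0 ≤ x) : Real.sinh x ≤ x * Real.cosh x := by
  have hderiv : ∀ y : ℝ, HasDerivAt (fun y => y * Real.cosh y - Real.sinh y)
      (y * Real.sinh y) y := by
    intro y
    have := ((hasDerivAt_id y).mul (Real.hasDerivAt_cosh y)).sub (Real.hasDerivAt_sinh y)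
    refine this.congr_deriv ?_
    change 1 * Real.cosh y + y * Real.sinh y - Real.cosh y = _
    ring
  have hmono : MonotoneOn (fun y => y * Real.cosh y - Real.sinh y) (Set.Ici 0) := by
    refine monotoneOn_of_deriv_nonneg (convex_Ici 0)
      (fun y _ => (hderiv y).continuousAt.continuousWithinAt)
      (fun y _ => (hderiv y).differentiableAt.differentiableWithinAt) fun y hy => ?_
    rw [interior_Ici] at hy
    rw [(hderiv y).deriv]
    exact mul_nonneg hy.le (Real.sinh_nonneg_iff.2 hy.le)
  have := hmono (Set.mem_Ici.2 le_rfl) hx hx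
  simp at this
  linarith

lemma tanh_le_self {x : ℝ} (hx : 0 ≤ x) : Real.tanh x ≤ x := by
  rw [Real.tanh_eq_sinh_div_cosh, div_le_iff₀ (Real.cosh_pos x)]
  exact sinh_le_self_mul_cosh hx

lemma card_lt_pairs (p : ℕ) :
    2 * Fintype.card {e : Fin p × Fin p // e.1 < e.2} = p * (p - 1) := by
  rw [Fintype.card_subtype, Finset.card_filter, Fintype.sum_prod_type_right]
  have : ∀ b : Fin p, (∑ a : Fin p, if a < b then 1 else 0) = b.val := by
    intro b
    rw [← Finset.card_filter, Finset.filter_gt_eq_Iio, Fin.card_Iio]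
  simp only [this]
  rw [Fin.sum_univ_eq_sum_range (fun i => i) p, mul_comm, Finset.sum_range_id_mul_two]

/-- Hardness from detecting which single edge is present. -/
lemma exists_half_le_probn_of_single_edges {p n k : ℕ} {lam om : ℝ} (hp : 4 ≤ p) (hk : 1 ≤ k)
    (hlam : 0 < lam) (hlamom : lam ≤ om)
    (hn : (n : ℝ) ≤ Real.log p / (2 * lam * Real.tanh lam))
    (φ : (Fin n → Fin p → Bool) → SimpleGraph (Fin p)) :
    ∃ G ∈ edgeClass p k, ∃ θ : Fin p → Fin p → ℝ, ParamClass G lam om θ ∧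
      (1 : ℝ) / 2 ≤ probn n θ (fun xs => φ xs ≠ G) := by
  have hp0 : (0 : ℝ) < p := by exact_mod_cast (by omega : 0 < p)
  have hcard := card_lt_pairs p
  set N := Fintype.card {e : Fin p × Fin p // e.1 < e.2} with hNdef
  have hNp : (N : ℝ) * p ≤ ((N : ℝ) - 1) ^ 2 := by
    obtain rfl | hp5 : p = 4 ∨ 5 ≤ p := by omega
    · have : N = 6 := by omega
      rw [this]
      norm_num
    · have h1 : 2 * p ≤ N := by
        have : p * 4 ≤ p * (p - 1) := Nat.mul_le_mul_left p (by omega)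
        omega
      have h2 : (2 : ℝ) * p ≤ N := by exact_mod_cast h1
      have h3 : (5 : ℝ) ≤ p := by exact_mod_cast hp5
      nlinarith
  have hN2 : 2 ≤ N := by
    have : 4 * 3 ≤ p * (p - 1) := Nat.mul_le_mul hp (by omega)
    omega
  set z := Real.exp (Real.log p / 2) with hz
  have hz2 : z ^ 2 = p := by
    rw [hz, ← Real.exp_nat_mul]
    push_cast
    rw [mul_div_cancel₀ _ (two_ne_zero), Real.exp_log hp0]
  refine exists_half_le_probn (χ := z - 1) (ι := {e : Fin p × Fin p // e.1 < e.2}) hlam ⊥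
    (by simpa using hk) 0 ?_ (fun s => by simpa using hlamom) (fun e => e.1.1) (fun e => e.1.2)
    (fun e => e.2) (fun e => by simp) (fun e f h1 h2 => Subtype.ext (Prod.ext h1 h2))
    ?_ hN2 ?_ φ
  · refine ⟨⟨by simp, by simp⟩, by simp, by simp, fun s => by simpa using hlam.le.trans hlamom⟩
  · intro e
    rw [sum_sq_div_addCoupling 0 lam e.2 (1 / 2) (prob1_ne_zero_param e.2.ne).symm]
    have hcosh : Real.exp lam - 2 * (1 / 2) * Real.sinh lam = Real.cosh lam := by
      rw [← Real.cosh_add_sinh]; ring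
    have htanh : 1 + 1 / 2 * (1 - 1 / 2) * (2 * Real.sinh lam) ^ 2 / Real.cosh lam ^ 2 =
        1 + Real.tanh lam ^ 2 := by
      rw [Real.tanh_eq_sinh_div_cosh]; ring
    have ht := tanh_le_self hlam.le
    have ht0 : 0 < Real.tanh lam := by
      rw [Real.tanh_eq_sinh_div_cosh]
      exact div_pos (Real.sinh_pos_iff.2 hlam) (Real.cosh_pos _)
    rw [hcosh, htanh, add_sub_cancel, hz]
    rw [le_div_iff₀ (by positivity)] at hn
    calc (1 + Real.tanh lam ^ 2) ^ n ≤ Real.exp (Real.tanh lam ^ 2) ^ n := by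
          gcongr
          rw [add_comm]
          exact Real.add_one_le_exp _
      _ = Real.exp (n * Real.tanh lam ^ 2) := (Real.exp_nat_mul _ _).symm
      _ ≤ Real.exp (Real.log p / 2) := by
          gcongr
          have : (n : ℝ) * Real.tanh lam ^ 2 ≤ n * (lam * Real.tanh lam) := by
            gcongr
            nlinarith
          linarith
  · have h4 : 4 * (z - 1) ≤ p := by nlinarith [sq_nonneg (z - 2)]
    nlinarith [(Nat.cast_nonneg N : (0 : ℝ) ≤ N)]

lemma prob1_pathParam_add_two_le {p m : ℕ} (w : ℝ) {i j : Fin p} (hij : j.val = i.val + 2)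
    (hj : j.val < m) :
    prob1 (pathParam p m w) (fun x => x i ≠ x j) ≤ 2 * Real.exp (-(2 * w)) := by
  let l : Fin p := ⟨i.val + 1, by omega⟩
  have h1 := prob1_pathParam_succ_le (p := p) (m := m) w (i := i) (j := l) rfl
    (show i.val + 1 < m by omega)
  have h2 := prob1_pathParam_succ_le (p := p) (m := m) w (i := l) (j := j) hij hj
  have h3 := prob1_le_add (pathParam p m w) (fun x => x i ≠ x j) (fun x => x i ≠ x l)
    (fun x => x l ≠ x j) fun x h => by
      by_contra! h'
      exact h (h'.1.trans h'.2)
  linarith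

/-- Hardness from detecting a weak edge between strongly correlated vertices of a path. -/
lemma exists_half_le_probn_of_path {p n k m : ℕ} {lam om : ℝ} (hm : 4 ≤ m) (hpm : m ≤ p)
    (hmk : m ≤ k) (hk : 8 ≤ k) (hkm : 9 * k ≤ 8 * m ^ 2)
    (hlam : 0 < lam) (hom : 1 ≤ om) (hlamm : 4 * lam ≤ om)
    (hn : (n : ℝ) ≤ Real.exp (om / 2) * Real.log ((k : ℝ) / 8) /
            (64 * om * Real.exp (5 * lam / 2) * Real.sinh lam))
    (φ : (Fin n → Fin p → Bool) → SimpleGraph (Fin p)) :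
    ∃ G ∈ edgeClass p k, ∃ θ : Fin p → Fin p → ℝ, ParamClass G lam om θ ∧
      (1 : ℝ) / 2 ≤ probn n θ (fun xs => φ xs ≠ G) := by
  set w := (om - lam) / 2 with hw
  have hlw : lam ≤ w := by rw [hw]; linarith
  have hk8 : (8 : ℝ) ≤ k := by exact_mod_cast hk
  have hm4 : (4 : ℝ) ≤ m := by exact_mod_cast hm
  set L := Real.log ((k : ℝ) / 8) with hL
  have hL0 : 0 ≤ L := Real.log_nonneg (by linarith)
  have hS : 0 < Real.sinh lam := Real.sinh_pos_iff.2 hlam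
  set y := Real.exp (L / 8) with hy
  have hy0 : 0 < y := Real.exp_pos _
  have hcast : ((m - 2 : ℕ) : ℝ) = (m : ℝ) - 2 := by
    rw [Nat.cast_sub (by omega)]; norm_num
  refine exists_half_le_probn (χ := y - 1) (ι := Fin (m - 2)) hlam (initialPath p m)
    ?_ (pathParam p m w) (paramClass_pathParam hlam hlw (by rw [hw]; linarith)) ?_
    (fun i => ⟨i.val, by omega⟩) (fun i => ⟨i.val + 2, by omega⟩)
    (fun i => by simp [Fin.lt_def]) ?_ ?_ ?_ (by simp; omega) ?_ φ
  · have := ncard_edgeSet_initialPath_le p m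
    omega
  · intro s
    have := sum_abs_pathParam_le (p := p) (m := m) (hlam.le.trans hlw) s
    linarith
  · rintro i (h | h)
    · simp at h
    · simp at h
      omega
  · intro i j h _
    exact Fin.ext (Fin.mk.inj_iff.1 h)
  · intro i
    set a : Fin p := ⟨i.val, by omega⟩
    set b : Fin p := ⟨i.val + 2, by omega⟩
    set q := prob1 (pathParam p m w) (fun x => x a ≠ x b) with hq
    have hq0 : 0 ≤ q := prob1_nonneg _ _
    have hq1 : q ≤ 1 := prob1_le_one _ _
    have hq2 : q ≤ 2 * Real.exp (-(2 * w)) :=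
      prob1_pathParam_add_two_le w (i := a) (j := b) rfl (show i.val + 2 < m by omega)
    rw [sum_sq_div_addCoupling _ lam (by simp [a, b, Fin.lt_def]) q hq, add_sub_cancel]
    have hden : Real.exp (-lam) ≤ Real.exp lam - 2 * q * Real.sinh lam := by
      have : Real.exp lam - Real.exp (-lam) = 2 * Real.sinh lam := by rw [Real.sinh_eq]; ring
      nlinarith
    have hterm : q * (1 - q) * (2 * Real.sinh lam) ^ 2 /
        (Real.exp lam - 2 * q * Real.sinh lam) ^ 2 ≤
        8 * Real.exp (3 * lam - om) * Real.sinh lam ^ 2 := by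
      calc _ ≤ q * (2 * Real.sinh lam) ^ 2 / Real.exp (-lam) ^ 2 := by
            gcongr
            nlinarith
        _ ≤ 2 * Real.exp (-(2 * w)) * (2 * Real.sinh lam) ^ 2 / Real.exp (-lam) ^ 2 := by
            gcongr
        _ = _ := by
            have : Real.exp (3 * lam - om) = Real.exp (-(2 * w)) / Real.exp (-lam) ^ 2 := by
              rw [← Real.exp_nat_mul, ← Real.exp_sub, hw]
              congr 1
              push_cast
              ring
            rw [this]
            ring
    calc _ ≤ Real.exp (8 * Real.exp (3 * lam - om) * Real.sinh lam ^ 2) ^ n := by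
          have h0 : 0 ≤ q * (1 - q) * (2 * Real.sinh lam) ^ 2 /
              (Real.exp lam - 2 * q * Real.sinh lam) ^ 2 :=
            div_nonneg (mul_nonneg (mul_nonneg hq0 (by linarith)) (sq_nonneg _)) (sq_nonneg _)
          gcongr
          rw [add_comm]
          exact (add_le_add_left hterm 1).trans (Real.add_one_le_exp _)
      _ = Real.exp (n * (8 * Real.exp (3 * lam - om) * Real.sinh lam ^ 2)) :=
          (Real.exp_nat_mul _ _).symm
      _ ≤ y := by
          rw [hy]
          gcongr
          have hsinh : Real.sinh lam ≤ Real.exp lam := by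
            rw [← Real.cosh_add_sinh]
            linarith [Real.cosh_pos lam]
          calc _ ≤ Real.exp (om / 2) * L /
                (64 * om * Real.exp (5 * lam / 2) * Real.sinh lam) *
                (8 * Real.exp (3 * lam - om) * Real.sinh lam ^ 2) := by
                gcongr
            _ = L / 8 * (Real.exp (om / 2) / Real.exp (5 * lam / 2) *
                Real.exp (3 * lam - om) * Real.sinh lam / om) := by
                field_simp
                ring
            _ ≤ L / 8 * (Real.exp (om / 2) / Real.exp (5 * lam / 2) *
                Real.exp (3 * lam - om) * Real.exp lam / 1) := by
                gcongr
            _ = L / 8 * Real.exp (3 * lam / 2 - om / 2) := by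
                rw [← Real.exp_sub, ← Real.exp_add, ← Real.exp_add, div_one]
                congr 2
                ring
            _ ≤ L / 8 * 1 := by
                gcongr
                exact Real.exp_le_one_iff.2 (by linarith)
            _ = L / 8 := mul_one _
  · rw [Fintype.card_fin, hcast]
    have hy8 : (y ^ 4) ^ 2 = (k : ℝ) / 8 := by
      rw [hy, ← pow_mul, ← Real.exp_nat_mul]
      rw [show ((4 * 2 : ℕ) : ℝ) * (L / 8) = L by push_cast; ring, hL, Real.exp_log (by linarith)]
    have hkm' : (9 : ℝ) * k ≤ 8 * (m : ℝ) ^ 2 := by exact_mod_cast hkm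
    have hy4 : y ^ 4 ≤ (m : ℝ) / 3 := by
      rw [← pow_le_pow_iff_left₀ (by positivity) (by positivity) two_ne_zero, hy8]
      linarith
    have hy1 : 4 * (y - 1) ≤ y ^ 4 - 1 := by
      nlinarith [sq_nonneg (y - 1), sq_nonneg (y ^ 2 - 1)]
    have : 12 * (y - 1) ≤ (m : ℝ) - 3 := by linarith
    nlinarith


/-- Theorem 2 (Necessary conditions for `G_{p,k}`): if the sample size is below the
stated threshold, any graph decoder fails with probability at least `1/2` for some
model in the class. Here `m` is the largest integer with `m(m-1)/2 ≤ k+1`. -/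
theorem necessary_conditions_edge (p k n m : ℕ) (lam om : ℝ)
    (hp : 2 ≤ p) (hk : 8 ≤ k)
    (hm : m * (m - 1) / 2 ≤ k + 1)
    (hmmax : ∀ m' : ℕ, m' * (m' - 1) / 2 ≤ k + 1 → m' ≤ m)
    (hpm : m ≤ p)
    (hlam : 0 < lam) (hom : 1 ≤ om) (hlamm : lam * (m : ℝ) ≤ om) (hlamom : lam ≤ om)
    (hn : (n : ℝ) ≤
        max (Real.log p / (2 * lam * Real.tanh lam))
          (Real.exp (om / 2) * Real.log ((k : ℝ) / 8) /
            (64 * om * Real.exp (5 * lam / 2) * Real.sinh lam)))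
    (φ : (Fin n → Fin p → Bool) → SimpleGraph (Fin p))
    (hφ : ∀ xs, φ xs ∈ edgeClass p k) :
    ∃ G ∈ edgeClass p k, ∃ θ : Fin p → Fin p → ℝ, ParamClass G lam om θ ∧
      (1 : ℝ) / 2 ≤ probn n θ (fun xs => φ xs ≠ G) := by
  have hm4 : 4 ≤ m := hmmax 4 (by omega)
  rcases le_max_iff.1 hn with h | h
  · exact exists_half_le_probn_of_single_edges (hm4.trans hpm) (by omega) hlam hlamom h φ
  · have hmk : m ≤ k := by
      obtain rfl | hm5 : m = 4 ∨ 5 ≤ m := by omega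
      · omega
      · have : m * 4 ≤ m * (m - 1) := Nat.mul_le_mul_left m (by omega)
        omega
    have hkm : 2 * k + 4 ≤ m ^ 2 + m := by
      by_contra! hlt
      have h1 : (m + 1) * (m + 1 - 1) = m ^ 2 + m := by rw [Nat.add_sub_cancel]; ring
      have := hmmax (m + 1) (by rw [h1]; omega)
      omega
    have hm4' : (4 : ℝ) ≤ m := by exact_mod_cast hm4
    exact exists_half_le_probn_of_path hm4 hpm hmk hk (by nlinarith) hlam hom (by nlinarith) h φ
end
end

section
/- Let p ≥ 2, d ≥ 1 be integers, λ, ω > 0 reals, and δ ∈ (0,1). If the sample size satisfies n > (ω(3 exp(2ω)+1)/sinh²(λ/4))² · (16 log p + 4 log(2/δ)), then there exists a graph decoder φ† : ({−1,+1}^p)^n → G_{p,d} such that for every graph G ∈ G_{p,d} and every parameter vector θ ∈ Θ_{λ,ω}(G), the probability under n i.i.d. samples X_1,…,X_n from the Ising model P_θ that φ†(X_1,…,X_n) ≠ G is at most δ. -/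
open scoped Classical BigOperators
open Real

noncomputable section

/-- The configuration `x` with the spin at `t` reversed. -/
def flipAt {p : ℕ} (t : Fin p) (x : Fin p → Bool) : Fin p → Bool :=
  Function.update x t (!x t)

/-- The linear form `Σ_t w_t x_t` in the spins. -/
def linForm {p : ℕ} (w : Fin p → ℝ) (x : Fin p → Bool) : ℝ :=
  ∑ t, w t * sgn (x t)

/-- Conditional log-likelihood, up to a constant, of the spin at `s` given the others,
for coupling vector `w`. -/
def condLogLik {p : ℕ} (s : Fin p) (w : Fin p → ℝ) (x : Fin p → Bool) : ℝ :=
  sgn (x s) * linForm w x - Real.log (Real.cosh (linForm w x))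

/-- The part of the energy not involving the spin at `s`. -/
def restEnergy {p : ℕ} (θ : Fin p → Fin p → ℝ) (s : Fin p) (x : Fin p → Bool) : ℝ :=
  energy θ x - sgn (x s) * linForm (θ s) x

lemma sgn_eq_or (b : Bool) : sgn b = 1 ∨ sgn b = -1 := by
  cases b <;> simp [sgn]

lemma abs_sgn (b : Bool) : |sgn b| = 1 := by
  cases b <;> simp [sgn]

lemma flipAt_flipAt {p : ℕ} (t : Fin p) (x : Fin p → Bool) : flipAt t (flipAt t x) = x := by
  simp [flipAt]

lemma sgn_flipAt {p : ℕ} (t u : Fin p) (x : Fin p → Bool) :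
    sgn (flipAt t x u) = sgn (x u) + if u = t then -2 * sgn (x t) else 0 := by
  by_cases h : u = t
  · subst h
    simp [flipAt, sgn_not]
    ring
  · simp [flipAt, h]

lemma sum_flipAt {p : ℕ} (t : Fin p) (F : (Fin p → Bool) → ℝ) :
    ∑ x, F (flipAt t x) = ∑ x, F x :=
  Equiv.sum_comp (Function.Involutive.toPerm (flipAt t) (flipAt_flipAt t)) F

/-- A sum over configurations can be bounded by bounding pairs related by a spin flip. -/
lemma sum_le_sum_of_flipAt {p : ℕ} (t : Fin p) (F H : (Fin p → Bool) → ℝ)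
    (h : ∀ x, F x + F (flipAt t x) ≤ H x + H (flipAt t x)) : ∑ x, F x ≤ ∑ x, H x := by
  have h1 := Finset.sum_le_sum fun x (_ : x ∈ Finset.univ) => h x
  rw [Finset.sum_add_distrib, Finset.sum_add_distrib, sum_flipAt, sum_flipAt] at h1
  linarith

lemma linForm_flipAt {p : ℕ} (w : Fin p → ℝ) (t : Fin p) (x : Fin p → Bool) :
    linForm w (flipAt t x) = linForm w x - 2 * w t * sgn (x t) := by
  simp only [linForm, sgn_flipAt, mul_add, Finset.sum_add_distrib, mul_ite, mul_zero,
    Finset.sum_ite_eq', Finset.mem_univ, if_true]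
  ring

lemma linForm_sub {p : ℕ} (w v : Fin p → ℝ) (x : Fin p → Bool) :
    linForm w x - linForm v x = linForm (fun t => w t - v t) x := by
  simp only [linForm, sub_mul, Finset.sum_sub_distrib]

lemma abs_linForm_le {p : ℕ} (w : Fin p → ℝ) (x : Fin p → Bool) :
    |linForm w x| ≤ ∑ t, |w t| := by
  refine (Finset.abs_sum_le_sum_abs _ _).trans (le_of_eq ?_)
  simp [abs_mul, abs_sgn]

lemma two_mul_energy {p : ℕ} {θ : Fin p → Fin p → ℝ} (hθ : IsSymParam θ) (x : Fin p → Bool) :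
    2 * energy θ x = ∑ s, sgn (x s) * linForm (θ s) x := by
  have h1 : energy θ x =
      ∑ s : Fin p, ∑ t : Fin p, if t < s then θ s t * sgn (x s) * sgn (x t) else 0 := by
    rw [energy, Finset.sum_comm]
    refine Finset.sum_congr rfl fun s _ => Finset.sum_congr rfl fun t _ => ?_
    rw [hθ.1 t s]
    split_ifs <;> ring
  rw [two_mul]
  nth_rewrite 2 [h1]
  rw [energy, ← Finset.sum_add_distrib]
  refine Finset.sum_congr rfl fun s _ => ?_
  rw [linForm, ← Finset.sum_add_distrib, Finset.mul_sum]
  refine Finset.sum_congr rfl fun t _ => ?_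
  rcases lt_trichotomy s t with h | h | h
  · simp [h, h.not_gt]; ring
  · subst h; simp [hθ.2]
  · simp [h, h.not_gt]; ring

lemma energy_flipAt {p : ℕ} {θ : Fin p → Fin p → ℝ} (hθ : IsSymParam θ) (s : Fin p)
    (x : Fin p → Bool) :
    energy θ (flipAt s x) = energy θ x - 2 * sgn (x s) * linForm (θ s) x := by
  have h1 := two_mul_energy hθ x
  have h2 := two_mul_energy hθ (flipAt s x)
  have h3 : ∑ u, sgn (flipAt s x u) * linForm (θ u) (flipAt s x) =
      ∑ u, sgn (x u) * linForm (θ u) x - 4 * sgn (x s) * linForm (θ s) x := by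
    have h4 : ∀ u, sgn (flipAt s x u) * linForm (θ u) (flipAt s x) =
        sgn (x u) * linForm (θ u) x - 2 * sgn (x s) * (θ s u * sgn (x u)) +
        (if u = s then -2 * sgn (x s) * (linForm (θ u) x - 2 * θ u s * sgn (x s)) else 0) := by
      intro u
      rw [sgn_flipAt, linForm_flipAt, hθ.1 s u]
      split_ifs <;> ring
    simp only [h4, Finset.sum_add_distrib, Finset.sum_sub_distrib, Finset.sum_ite_eq',
      Finset.mem_univ, if_true, ← Finset.mul_sum]
    rw [hθ.2 s, ← linForm]
    ring
  linarith

lemma restEnergy_flipAt_self {p : ℕ} {θ : Fin p → Fin p → ℝ} (hθ : IsSymParam θ) (s : Fin p)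
    (x : Fin p → Bool) : restEnergy θ s (flipAt s x) = restEnergy θ s x := by
  rw [restEnergy, restEnergy, energy_flipAt hθ, linForm_flipAt, hθ.2, sgn_flipAt]
  simp
  ring

lemma abs_restEnergy_flipAt_sub_le {p : ℕ} {θ : Fin p → Fin p → ℝ} (hθ : IsSymParam θ) {om : ℝ}
    (hom : ∀ s, ∑ t, |θ s t| ≤ om) {s t : Fin p} (hst : s ≠ t) (x : Fin p → Bool) :
    |restEnergy θ s (flipAt t x) - restEnergy θ s x| ≤ 2 * om := by
  have h1 : restEnergy θ s (flipAt t x) - restEnergy θ s x =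
      -2 * (sgn (x t) * linForm (Function.update (θ t) s 0) x) := by
    have h2 : linForm (Function.update (θ t) s 0) x = linForm (θ t) x - θ s t * sgn (x s) := by
      have h3 : ∀ u, Function.update (θ t) s 0 u * sgn (x u) =
          θ t u * sgn (x u) - if u = s then θ s t * sgn (x s) else 0 := by
        intro u
        by_cases h : u = s
        · subst h; simp [hθ.1 t u]
        · simp [h]
      simp only [linForm, h3, Finset.sum_sub_distrib, Finset.sum_ite_eq', Finset.mem_univ, if_true]
    rw [restEnergy, restEnergy, energy_flipAt hθ, linForm_flipAt, sgn_flipAt, h2]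
    simp [hst]
    ring
  rw [h1, abs_mul, abs_mul, abs_sgn]
  have h4 := abs_linForm_le (Function.update (θ t) s 0) x
  have h5 : ∑ u, |Function.update (θ t) s 0 u| ≤ ∑ u, |θ t u| := by
    refine Finset.sum_le_sum fun u _ => ?_
    by_cases h : u = s
    · subst h; simp
    · simp [h]
  have h6 := hom t
  norm_num
  linarith

lemma isingP_eq {p : ℕ} (θ : Fin p → Fin p → ℝ) (s : Fin p) (x : Fin p → Bool) :
    isingP θ x = Real.exp (restEnergy θ s x) / Zpart θ *
      Real.exp (sgn (x s) * linForm (θ s) x) := by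
  rw [isingP, div_mul_eq_mul_div, ← Real.exp_add, restEnergy, sub_add_cancel]

lemma isingP_nonneg {p : ℕ} (θ : Fin p → Fin p → ℝ) (x : Fin p → Bool) : 0 ≤ isingP θ x :=
  div_nonneg (Real.exp_pos _).le (Zpart_pos θ).le

/-- Union bound combined with the exponential Markov inequality for product functionals. -/
lemma probn_le_sum_pow {p n : ℕ} (θ : Fin p → Fin p → ℝ)
    (A : (Fin n → Fin p → Bool) → Prop) {ι : Type*} (J : Finset ι)
    (g : ι → (Fin p → Bool) → ℝ) (hg : ∀ j x, 0 ≤ g j x)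
    (hA : ∀ xs, A xs → ∃ j ∈ J, 1 ≤ ∏ i, g j (xs i)) :
    probn n θ A ≤ ∑ j ∈ J, (∑ x, isingP θ x * g j x) ^ n := by
  have h1 : ∀ j, (∑ x, isingP θ x * g j x) ^ n =
      ∑ xs : Fin n → Fin p → Bool, ∏ i, (isingP θ (xs i) * g j (xs i)) := by
    intro j
    rw [Fintype.sum_pow]
  simp only [h1]
  rw [Finset.sum_comm, probn]
  refine Finset.sum_le_sum fun xs _ => ?_
  have hP : 0 ≤ ∏ i, isingP θ (xs i) := Finset.prod_nonneg fun _ _ => isingP_nonneg _ _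
  have hnn : ∀ j, 0 ≤ ∏ i, (isingP θ (xs i) * g j (xs i)) := fun j =>
    Finset.prod_nonneg fun _ _ => mul_nonneg (isingP_nonneg _ _) (hg _ _)
  split_ifs with h
  · obtain ⟨j, hj, hj1⟩ := hA xs h
    calc ∏ i, isingP θ (xs i) ≤ ∏ i, (isingP θ (xs i) * g j (xs i)) := by
          rw [Finset.prod_mul_distrib]
          exact le_mul_of_one_le_right hP hj1
      _ ≤ _ := Finset.single_le_sum (f := fun j => ∏ i, (isingP θ (xs i) * g j (xs i)))
          (fun j _ => hnn j) hj
  · exact Finset.sum_nonneg fun j _ => hnn j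

lemma two_mul_sinh_sq_le (c y : ℝ) :
    2 * Real.sinh y ^ 2 ≤ Real.sinh (c + y) ^ 2 + Real.sinh (c - y) ^ 2 := by
  rw [Real.sinh_add, Real.sinh_sub]
  have h1 := Real.cosh_sq c
  have h2 := Real.cosh_sq y
  have : (Real.sinh c * Real.cosh y + Real.cosh c * Real.sinh y) ^ 2 +
      (Real.sinh c * Real.cosh y - Real.cosh c * Real.sinh y) ^ 2 =
      2 * Real.sinh c ^ 2 * Real.cosh y ^ 2 + 2 * Real.cosh c ^ 2 * Real.sinh y ^ 2 := by ring
  rw [this, h1, h2]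
  nlinarith [sq_nonneg (Real.sinh c), sq_nonneg (Real.sinh y),
    mul_nonneg (sq_nonneg (Real.sinh c)) (sq_nonneg (Real.sinh y))]

lemma cosh_le_cosh_of_abs_le {x y : ℝ} (h : |x| ≤ y) : Real.cosh x ≤ Real.cosh y :=
  Real.cosh_le_cosh.2 (h.trans (le_abs_self y))

lemma cosh_le_exp {x : ℝ} (hx : 0 ≤ x) : Real.cosh x ≤ Real.exp x := by
  rw [Real.cosh_eq]
  have : Real.exp (-x) ≤ Real.exp x := Real.exp_le_exp.2 (by linarith)
  linarith

lemma cosh_add_mul_sinh_le {T δ : ℝ} (hT : |T| ≤ 1) (hδ : |δ| ≤ 1) :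
    Real.cosh δ + T * Real.sinh δ ≤ Real.exp (T * δ + δ ^ 2) := by
  have h1 := (abs_le.1 (Real.abs_exp_sub_one_sub_id_le hδ)).2
  have h2 := (abs_le.1 (Real.abs_exp_sub_one_sub_id_le (x := -δ) (by rwa [abs_neg]))).2
  have h3 := Real.add_one_le_exp (T * δ + δ ^ 2)
  rw [abs_le] at hT
  rw [Real.cosh_eq, Real.sinh_eq]
  nlinarith [mul_le_mul_of_nonneg_left h1 (by linarith : 0 ≤ 1 + T),
    mul_le_mul_of_nonneg_left h2 (by linarith : 0 ≤ 1 - T)]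

lemma abs_tanh_le_one (x : ℝ) : |Real.tanh x| ≤ 1 := by
  rw [Real.tanh_eq_sinh_div_cosh, abs_div, abs_of_pos (Real.cosh_pos x),
    div_le_one (Real.cosh_pos x), abs_le]
  have := Real.cosh_sq x
  constructor <;> nlinarith [Real.cosh_pos x]

lemma cosh_add_eq (a b : ℝ) :
    Real.cosh (a + b) = Real.cosh a * (Real.cosh b + Real.tanh a * Real.sinh b) := by
  rw [Real.tanh_eq_sinh_div_cosh, Real.cosh_add]
  field_simp [(Real.cosh_pos a).ne']

/-- Squared-Hellinger-type discrepancy of two spins with fields `η` and `η'`. -/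
def fieldGap (η η' : ℝ) : ℝ :=
  Real.sinh ((η' - η) / 2) ^ 2 / (Real.cosh η * Real.cosh η')

lemma fieldGap_nonneg (η η' : ℝ) : 0 ≤ fieldGap η η' :=
  div_nonneg (sq_nonneg _) (mul_pos (Real.cosh_pos _) (Real.cosh_pos _)).le

lemma cosh_midpoint_sq (η η' : ℝ) :
    Real.cosh ((η + η') / 2) ^ 2 = Real.cosh η * Real.cosh η' * (1 - fieldGap η η') := by
  have h : Real.cosh η * Real.cosh η' * (1 - fieldGap η η') =
      Real.cosh η * Real.cosh η' - Real.sinh ((η' - η) / 2) ^ 2 := by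
    rw [fieldGap]
    field_simp [(Real.cosh_pos η).ne', (Real.cosh_pos η').ne']
  rw [h]
  set a := (η + η') / 2 with ha
  set u := (η' - η) / 2 with hu
  have e1 : η = a - u := by rw [ha, hu]; ring
  have e2 : η' = a + u := by rw [ha, hu]; ring
  rw [e1, e2, Real.cosh_add, Real.cosh_sub]
  have h1 := Real.cosh_sq a
  have h2 := Real.cosh_sq u
  have : (Real.cosh a * Real.cosh u - Real.sinh a * Real.sinh u) *
      (Real.cosh a * Real.cosh u + Real.sinh a * Real.sinh u) =
      Real.cosh a ^ 2 * Real.cosh u ^ 2 - Real.sinh a ^ 2 * Real.sinh u ^ 2 := by ring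
  rw [this, h1, h2]
  ring

lemma fieldGap_le_one (η η' : ℝ) : fieldGap η η' ≤ 1 := by
  have h := cosh_midpoint_sq η η'
  have h1 := sq_nonneg (Real.cosh ((η + η') / 2))
  have h2 := mul_pos (Real.cosh_pos η) (Real.cosh_pos η')
  by_contra! h3
  nlinarith

lemma tanh_sub_tanh_sq_le (η η' : ℝ) :
    (Real.tanh η - Real.tanh ((η + η') / 2)) ^ 2 ≤ 4 * fieldGap η η' := by
  set a := (η + η') / 2 with ha
  have hc := Real.cosh_pos a
  have hc1 := Real.cosh_pos η
  have hc2 := Real.cosh_pos η'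
  have h1 : Real.tanh η - Real.tanh a =
      -Real.sinh ((η' - η) / 2) / (Real.cosh a * Real.cosh η) := by
    have : (η' - η) / 2 = a - η := by rw [ha]; ring
    rw [this, Real.tanh_eq_sinh_div_cosh, Real.tanh_eq_sinh_div_cosh, Real.sinh_sub]
    field_simp
    ring
  have h2 : Real.cosh η' ≤ 4 * Real.cosh a ^ 2 * Real.cosh η := by
    have e : η' = 2 * a - η := by rw [ha]; ring
    have h3 : Real.cosh (2 * a - η) + Real.cosh (2 * a + η) =
        2 * Real.cosh (2 * a) * Real.cosh η := by
      rw [Real.cosh_add, Real.cosh_sub]; ring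
    have h4 := Real.cosh_pos (2 * a + η)
    have h5 := Real.cosh_two_mul a
    have h6 := Real.cosh_sq a
    rw [e]
    nlinarith
  rw [h1, fieldGap, div_pow, neg_sq, mul_div_assoc', div_le_div_iff₀ (by positivity) (by positivity)]
  nlinarith [mul_le_mul_of_nonneg_left h2
    (mul_nonneg (sq_nonneg (Real.sinh ((η' - η) / 2))) hc1.le)]

/-- Affinity bound for one spin with field `η`, when the reference likelihood uses a slightly
wrong field `η₀`. -/
lemma exp_half_logLik_le {η η' η₀ ε : ℝ} (hε : |η₀ - η| ≤ ε) (hε1 : ε ≤ 1) :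
    Real.cosh (η + (η' - η₀) / 2) *
        Real.exp ((Real.log (Real.cosh η₀) - Real.log (Real.cosh η')) / 2) ≤
      Real.cosh η * (Real.exp (7 / 4 * ε ^ 2) * (1 - fieldGap η η' / 8)) := by
  set δ := η₀ - η with hδ
  set a := (η + η') / 2 with ha
  set D := fieldGap η η' with hD
  have hD0 : 0 ≤ D := fieldGap_nonneg _ _
  have hD1 : D ≤ 1 := fieldGap_le_one _ _
  have hc := Real.cosh_pos η
  have hc' := Real.cosh_pos η'
  have hδ1 : |δ| ≤ 1 := hε.trans hε1
  have hδε : δ ^ 2 ≤ ε ^ 2 := by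
    rw [← sq_abs δ]; exact pow_le_pow_left₀ (abs_nonneg _) hε 2
  have hB : Real.cosh (η + (η' - η₀) / 2) ≤
      Real.cosh a * Real.exp (Real.tanh a * (-δ / 2) + δ ^ 2 / 4) := by
    have e : η + (η' - η₀) / 2 = a + -δ / 2 := by rw [ha, hδ]; ring
    rw [e, cosh_add_eq]
    refine mul_le_mul_of_nonneg_left ?_ (Real.cosh_pos a).le
    refine (cosh_add_mul_sinh_le (abs_tanh_le_one a) ?_).trans (le_of_eq ?_)
    · rw [abs_div, abs_neg]; norm_num; linarith
    · congr 1; ring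
  have hC : Real.cosh η₀ ≤ Real.cosh η * Real.exp (Real.tanh η * δ + δ ^ 2) := by
    have e : η₀ = η + δ := by rw [hδ]; ring
    rw [e, cosh_add_eq]
    exact mul_le_mul_of_nonneg_left (cosh_add_mul_sinh_le (abs_tanh_le_one η) hδ1) hc.le
  have hq := tanh_sub_tanh_sq_le η η'
  rw [← ha, ← hD] at hq
  have hmain : (Real.cosh (η + (η' - η₀) / 2) *
      Real.exp ((Real.log (Real.cosh η₀) - Real.log (Real.cosh η')) / 2)) ^ 2 ≤
      (Real.cosh η * Real.exp (7 / 4 * ε ^ 2 - D / 4)) ^ 2 := by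
    have e1 : Real.exp ((Real.log (Real.cosh η₀) - Real.log (Real.cosh η')) / 2) ^ 2 =
        Real.cosh η₀ / Real.cosh η' := by
      rw [← Real.exp_nat_mul, Nat.cast_ofNat, mul_div_cancel₀ _ (two_ne_zero), Real.exp_sub,
        Real.exp_log (Real.cosh_pos _), Real.exp_log hc']
    rw [mul_pow, e1]
    calc Real.cosh (η + (η' - η₀) / 2) ^ 2 * (Real.cosh η₀ / Real.cosh η')
        ≤ (Real.cosh a * Real.exp (Real.tanh a * (-δ / 2) + δ ^ 2 / 4)) ^ 2 *
          (Real.cosh η * Real.exp (Real.tanh η * δ + δ ^ 2) / Real.cosh η') := by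
          gcongr
      _ = Real.cosh η ^ 2 * ((1 - D) *
          Real.exp ((Real.tanh η - Real.tanh a) * δ + 3 / 2 * δ ^ 2)) := by
          have e2 : Real.exp ((Real.tanh η - Real.tanh a) * δ + 3 / 2 * δ ^ 2) =
              Real.exp (Real.tanh a * (-δ / 2) + δ ^ 2 / 4) ^ 2 *
              Real.exp (Real.tanh η * δ + δ ^ 2) := by
            rw [← Real.exp_nat_mul, ← Real.exp_add]; congr 1; push_cast; ring
          rw [e2, mul_pow, ha, cosh_midpoint_sq, ← hD]
          field_simp
      _ ≤ Real.cosh η ^ 2 * (Real.exp (-D) *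
          Real.exp ((Real.tanh η - Real.tanh a) * δ + 3 / 2 * δ ^ 2)) := by
          gcongr
          have := Real.add_one_le_exp (-D)
          linarith
      _ ≤ (Real.cosh η * Real.exp (7 / 4 * ε ^ 2 - D / 4)) ^ 2 := by
          rw [mul_pow, ← Real.exp_add, ← Real.exp_nat_mul]
          gcongr
          push_cast
          nlinarith [sq_nonneg ((Real.tanh η - Real.tanh a) - 4 * δ)]
  have h1 := le_of_sq_le_sq hmain (mul_pos hc (Real.exp_pos _)).le
  refine h1.trans (mul_le_mul_of_nonneg_left ?_ hc.le)
  rw [sub_eq_add_neg, Real.exp_add]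
  refine mul_le_mul_of_nonneg_left ?_ (Real.exp_pos _).le
  have h2 := (abs_le.1 (Real.abs_exp_sub_one_sub_id_le (x := -(D / 4))
    (by rw [abs_neg, abs_of_nonneg] <;> linarith))).2
  nlinarith

/-- Under the Ising model, the fields of two coupling vectors that differ by at least `lam` in
some coordinate have average discrepancy bounded below. -/
lemma le_sum_isingP_mul_fieldGap {p : ℕ} {θ : Fin p → Fin p → ℝ} (hθ : IsSymParam θ) {om lam : ℝ}
    (hom0 : 0 ≤ om) (hlam : 0 ≤ lam) (hom : ∀ s, ∑ t, |θ s t| ≤ om) {s t : Fin p} (hst : s ≠ t)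
    {w : Fin p → ℝ} (hw : ∑ u, |w u| ≤ om) (hws : w s = 0) (hgap : lam ≤ |w t - θ s t|) :
    Real.sinh (lam / 2) ^ 2 / Real.exp (4 * om) ≤
      ∑ x, isingP θ x * fieldGap (linForm (θ s) x) (linForm w x) := by
  set Q : (Fin p → Bool) → ℝ := fun x => Real.exp (restEnergy θ s x) with hQ
  set U : (Fin p → Bool) → ℝ := fun x =>
    Real.sinh ((linForm w x - linForm (θ s) x) / 2) ^ 2 with hU
  have hZ := Zpart_pos θ
  have hco := Real.cosh_pos om
  have hsflip : ∀ v : Fin p → ℝ, v s = 0 → ∀ x, linForm v (flipAt s x) = linForm v x := by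
    intro v hv x
    rw [linForm_flipAt, hv]; ring
  have hpair : ∀ x, isingP θ x + isingP θ (flipAt s x) =
      Q x / Zpart θ * (2 * Real.cosh (linForm (θ s) x)) := by
    intro x
    rw [isingP_eq θ s x, isingP_eq θ s (flipAt s x), restEnergy_flipAt_self hθ,
      hsflip _ (hθ.2 s), ← mul_add]
    congr 1
    rw [Real.cosh_eq, sgn_flipAt]
    rcases sgn_eq_or (x s) with h | h <;> simp [h] <;> ring_nf
  have hQs : ∀ x, Q (flipAt s x) = Q x := fun x => by
    simp only [hQ, restEnergy_flipAt_self hθ]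
  have hUs : ∀ x, U (flipAt s x) = U x := fun x => by
    simp only [hU, hsflip _ (hθ.2 s), hsflip _ hws]
  have h1 : ∑ x, Q x * U x / (Zpart θ * Real.cosh om) ≤
      ∑ x, isingP θ x * fieldGap (linForm (θ s) x) (linForm w x) := by
    refine sum_le_sum_of_flipAt s _ _ fun x => ?_
    rw [hsflip _ (hθ.2 s), hsflip _ hws, ← add_mul, hpair, hQs, hUs, fieldGap]
    have hc1 := Real.cosh_pos (linForm (θ s) x)
    have hc2 := Real.cosh_pos (linForm w x)
    have e : Q x / Zpart θ * (2 * Real.cosh (linForm (θ s) x)) *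
        (Real.sinh ((linForm w x - linForm (θ s) x) / 2) ^ 2 /
          (Real.cosh (linForm (θ s) x) * Real.cosh (linForm w x))) =
        2 * (Q x * U x / (Zpart θ * Real.cosh (linForm w x))) := by
      simp only [hU]; field_simp
    rw [e, ← two_mul]
    have h2 : Real.cosh (linForm w x) ≤ Real.cosh om :=
      cosh_le_cosh_of_abs_le ((abs_linForm_le w x).trans hw)
    have hQU : 0 ≤ Q x * U x := mul_nonneg (Real.exp_pos _).le (sq_nonneg _)
    gcongr
  have h2 : ∑ x, isingP θ x ≤ ∑ x, Q x * (Real.cosh om / Zpart θ) := by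
    refine sum_le_sum_of_flipAt s _ _ fun x => ?_
    rw [hpair, hQs]
    have h2 : Real.cosh (linForm (θ s) x) ≤ Real.cosh om :=
      cosh_le_cosh_of_abs_le ((abs_linForm_le _ x).trans (hom s))
    have : 0 ≤ Q x / Zpart θ := div_nonneg (Real.exp_pos _).le hZ.le
    calc Q x / Zpart θ * (2 * Real.cosh (linForm (θ s) x)) ≤
        Q x / Zpart θ * (2 * Real.cosh om) := by gcongr
      _ = _ := by ring
  have h3 : ∑ x, Q x * (Real.sinh (lam / 2) ^ 2 / Real.exp (2 * om)) ≤ ∑ x, Q x * U x := by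
    refine sum_le_sum_of_flipAt t _ _ fun x => ?_
    have hq : Q x ≤ Real.exp (2 * om) * Q (flipAt t x) ∧
        Q (flipAt t x) ≤ Real.exp (2 * om) * Q x := by
      have := abs_le.1 (abs_restEnergy_flipAt_sub_le hθ hom hst x)
      simp only [hQ, ← Real.exp_add]
      constructor <;> apply Real.exp_le_exp.2 <;> linarith
    have hu : 2 * Real.sinh (lam / 2) ^ 2 ≤ U x + U (flipAt t x) := by
      set Δ := (w t - θ s t) * sgn (x t) / 2 with hΔ
      set c := (linForm w x - linForm (θ s) x) / 2 - Δ with hcdef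
      have e1 : (linForm w x - linForm (θ s) x) / 2 = c + Δ := by rw [hcdef]; ring
      have e2 : (linForm w (flipAt t x) - linForm (θ s) (flipAt t x)) / 2 = c - Δ := by
        rw [linForm_flipAt, linForm_flipAt, hcdef, hΔ]; ring
      simp only [hU, e1, e2]
      refine le_trans ?_ (two_mul_sinh_sq_le c Δ)
      have h5 : |lam / 2| ≤ |Δ| := by
        rw [hΔ, abs_div, abs_div, abs_mul, abs_sgn, mul_one, abs_of_nonneg hlam]
        gcongr
      have h6 := Real.cosh_le_cosh.2 h5
      have h7 := Real.cosh_sq (lam / 2)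
      have h8 := Real.cosh_sq Δ
      nlinarith [Real.cosh_pos (lam / 2)]
    have hE := Real.exp_pos (2 * om)
    have hQx : 0 < Q x := Real.exp_pos _
    have hQt : 0 < Q (flipAt t x) := Real.exp_pos _
    have hU1 : 0 ≤ U x := sq_nonneg _
    have hU2 : 0 ≤ U (flipAt t x) := sq_nonneg _
    set E := Real.exp (2 * om)
    set S := Real.sinh (lam / 2) ^ 2
    have hS : 0 ≤ S := sq_nonneg _
    rw [← add_mul, mul_div_assoc', div_le_iff₀ hE]
    have hE1 : 1 ≤ E := Real.one_le_exp (by linarith)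
    rcases le_total (Q x) (Q (flipAt t x)) with h | h
    · have : Q x + Q (flipAt t x) ≤ 2 * (E * Q x) := by nlinarith
      calc (Q x + Q (flipAt t x)) * S ≤ 2 * (E * Q x) * S := by gcongr
        _ = E * Q x * (2 * S) := by ring
        _ ≤ E * Q x * (U x + U (flipAt t x)) := by gcongr
        _ = (Q x * U x + Q x * U (flipAt t x)) * E := by ring
        _ ≤ _ := by gcongr
    · have : Q x + Q (flipAt t x) ≤ 2 * (E * Q (flipAt t x)) := by nlinarith
      calc (Q x + Q (flipAt t x)) * S ≤ 2 * (E * Q (flipAt t x)) * S := by gcongr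
        _ = E * Q (flipAt t x) * (2 * S) := by ring
        _ ≤ E * Q (flipAt t x) * (U x + U (flipAt t x)) := by gcongr
        _ = (Q (flipAt t x) * U x + Q (flipAt t x) * U (flipAt t x)) * E := by ring
        _ ≤ _ := by gcongr
  rw [← Finset.sum_div] at h1
  rw [← Finset.sum_mul] at h2 h3
  rw [sum_isingP] at h2
  refine le_trans ?_ h1
  rw [le_div_iff₀ (mul_pos hZ hco)]
  refine le_trans ?_ h3
  have hZle : Zpart θ ≤ (∑ x, Q x) * Real.cosh om := by
    rwa [mul_div_assoc', le_div_iff₀ hZ, one_mul] at h2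
  have hce : Real.cosh om ^ 2 ≤ Real.exp (2 * om) := by
    rw [two_mul, Real.exp_add, ← sq]
    exact pow_le_pow_left₀ hco.le (cosh_le_exp hom0) 2
  have e4 : Real.exp (4 * om) = Real.exp (2 * om) * Real.exp (2 * om) := by
    rw [← Real.exp_add]; ring_nf
  have hQsum : 0 ≤ ∑ x, Q x := Finset.sum_nonneg fun _ _ => (Real.exp_pos _).le
  calc Real.sinh (lam / 2) ^ 2 / Real.exp (4 * om) * (Zpart θ * Real.cosh om)
      ≤ Real.sinh (lam / 2) ^ 2 / Real.exp (4 * om) *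
        ((∑ x, Q x) * Real.cosh om * Real.cosh om) := by gcongr
    _ = Real.sinh (lam / 2) ^ 2 / Real.exp (4 * om) * ((∑ x, Q x) * Real.cosh om ^ 2) := by ring
    _ ≤ Real.sinh (lam / 2) ^ 2 / Real.exp (4 * om) * ((∑ x, Q x) * Real.exp (2 * om)) := by
        gcongr
    _ = _ := by
        rw [e4]
        field_simp

/-- Affinity of the conditional likelihoods of `w` and of an approximation `v` of the true
coupling vector, under the Ising model. -/
lemma sum_isingP_mul_exp_le {p : ℕ} {θ : Fin p → Fin p → ℝ} (hθ : IsSymParam θ) {om lam ε : ℝ}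
    (hom0 : 0 ≤ om) (hlam : 0 ≤ lam) (hom : ∀ s, ∑ t, |θ s t| ≤ om) {s t : Fin p} (hst : s ≠ t)
    {w v : Fin p → ℝ} (hw : ∑ u, |w u| ≤ om) (hws : w s = 0) (hvs : v s = 0)
    (hgap : lam ≤ |w t - θ s t|) (hv : ∑ u, |v u - θ s u| ≤ ε) (hε1 : ε ≤ 1) :
    ∑ x, isingP θ x * Real.exp ((condLogLik s w x - condLogLik s v x) / 2) ≤
      Real.exp (7 / 4 * ε ^ 2 - Real.sinh (lam / 2) ^ 2 / Real.exp (4 * om) / 8) := by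
  have hsflip : ∀ v : Fin p → ℝ, v s = 0 → ∀ x, linForm v (flipAt s x) = linForm v x := by
    intro v hv x
    rw [linForm_flipAt, hv]; ring
  have h1 : ∑ x, isingP θ x * Real.exp ((condLogLik s w x - condLogLik s v x) / 2) ≤
      ∑ x, isingP θ x * (Real.exp (7 / 4 * ε ^ 2) *
        (1 - fieldGap (linForm (θ s) x) (linForm w x) / 8)) := by
    refine sum_le_sum_of_flipAt s _ _ fun x => ?_
    have hd : |linForm v x - linForm (θ s) x| ≤ ε := by
      rw [linForm_sub]; exact (abs_linForm_le _ x).trans hv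
    have key := exp_half_logLik_le (η' := linForm w x) hd hε1
    simp only [isingP_eq θ s, restEnergy_flipAt_self hθ, condLogLik, hsflip _ hws, hsflip _ hvs,
      hsflip _ (hθ.2 s)]
    set η := linForm (θ s) x
    set η' := linForm w x
    set η₀ := linForm v x
    set c := Real.exp (restEnergy θ s x) / Zpart θ
    have hc : 0 ≤ c := div_nonneg (Real.exp_pos _).le (Zpart_pos θ).le
    have hy : sgn (flipAt s x s) = -sgn (x s) := by rw [sgn_flipAt]; simp; ring
    rw [hy]
    have eL : ∀ y : ℝ, c * Real.exp (y * η) * Real.exp ((y * η' - Real.log (Real.cosh η') -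
        (y * η₀ - Real.log (Real.cosh η₀))) / 2) =
        c * (Real.exp (y * (η + (η' - η₀) / 2)) *
          Real.exp ((Real.log (Real.cosh η₀) - Real.log (Real.cosh η')) / 2)) := by
      intro y
      rw [mul_assoc, ← Real.exp_add, ← Real.exp_add]
      congr 2; ring
    have eC : ∀ z : ℝ, Real.exp (sgn (x s) * z) + Real.exp (-sgn (x s) * z) = 2 * Real.cosh z := by
      intro z
      rw [Real.cosh_eq]
      rcases sgn_eq_or (x s) with h | h <;> simp [h] <;> ring
    rw [eL, eL, ← mul_add, ← add_mul, ← add_mul, ← mul_add, eC, eC, mul_assoc, mul_assoc, mul_assoc]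
    refine mul_le_mul_of_nonneg_left ?_ hc
    exact mul_le_mul_of_nonneg_left key zero_le_two
  have h2 := le_sum_isingP_mul_fieldGap hθ hom0 hlam hom hst hw hws hgap
  have h3 : ∑ x, isingP θ x * (Real.exp (7 / 4 * ε ^ 2) *
      (1 - fieldGap (linForm (θ s) x) (linForm w x) / 8)) = Real.exp (7 / 4 * ε ^ 2) *
      (1 - (∑ x, isingP θ x * fieldGap (linForm (θ s) x) (linForm w x)) / 8) := by
    rw [← sum_isingP θ, Finset.sum_div, ← Finset.sum_sub_distrib, Finset.mul_sum]
    refine Finset.sum_congr rfl fun x _ => ?_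
    rw [sum_isingP]
    ring
  rw [h3] at h1
  refine h1.trans ?_
  rw [sub_eq_add_neg (_ * _), Real.exp_add]
  refine mul_le_mul_of_nonneg_left ?_ (Real.exp_pos _).le
  refine le_trans ?_ (Real.add_one_le_exp _)
  linarith

/-- A finite grid of reals of modulus at least `lam`, approximating from below in modulus. -/
lemma exists_grid {lam om h : ℝ} (hlam : 0 < lam) (hom : 0 ≤ om) (hh : 0 < h) :
    ∃ A : Finset ℝ, (A.card : ℝ) ≤ 2 * (om / h + 1) ∧ (∀ a ∈ A, lam ≤ |a|) ∧
      ∀ x : ℝ, lam ≤ |x| → |x| ≤ om → ∃ a ∈ A, |a| ≤ |x| ∧ |a - x| ≤ h := by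
  set B : Finset ℝ := (Finset.range (⌊om / h⌋₊ + 1)).image fun m : ℕ => lam + h * m with hB
  have hBc : (B.card : ℝ) ≤ om / h + 1 := by
    have h1 : B.card ≤ ⌊om / h⌋₊ + 1 := Finset.card_image_le.trans (by simp)
    have h2 := Nat.floor_le (div_nonneg hom hh.le)
    have h3 : (B.card : ℝ) ≤ (⌊om / h⌋₊ : ℝ) + 1 := by exact_mod_cast h1
    linarith
  have hBl : ∀ b ∈ B, lam ≤ b := by
    intro b hb
    obtain ⟨m, -, rfl⟩ := Finset.mem_image.1 hb
    have : 0 ≤ h * (m : ℝ) := by positivity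
    linarith
  have hBa : ∀ x : ℝ, lam ≤ x → x ≤ om → ∃ b ∈ B, b ≤ x ∧ x - b ≤ h := by
    intro x hx hxo
    have h0 : 0 ≤ (x - lam) / h := div_nonneg (by linarith) hh.le
    refine ⟨lam + h * (⌊(x - lam) / h⌋₊ : ℕ), Finset.mem_image.2 ⟨_, ?_, rfl⟩, ?_, ?_⟩
    · rw [Finset.mem_range, Nat.lt_succ_iff]
      apply Nat.floor_le_floor
      gcongr
      linarith
    · have := Nat.floor_le h0
      rw [le_div_iff₀ hh] at this
      linarith
    · have := (Nat.lt_floor_add_one ((x - lam) / h)).le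
      rw [div_le_iff₀ hh] at this
      linarith
  refine ⟨B ∪ B.image fun b => -b, ?_, ?_, ?_⟩
  · have h1 : (B ∪ B.image fun b => -b).card ≤ B.card + B.card :=
      (Finset.card_union_le _ _).trans (Nat.add_le_add_left Finset.card_image_le _)
    have h2 : ((B ∪ B.image fun b => -b).card : ℝ) ≤ (B.card : ℝ) + B.card := by exact_mod_cast h1
    linarith
  · intro a ha
    rcases Finset.mem_union.1 ha with ha | ha
    · exact (hBl a ha).trans (le_abs_self a)
    · obtain ⟨b, hb, rfl⟩ := Finset.mem_image.1 ha
      rw [abs_neg]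
      exact (hBl b hb).trans (le_abs_self b)
  · intro x hx hxo
    obtain ⟨b, hb, hbx, hxb⟩ := hBa |x| hx hxo
    have hb0 : 0 ≤ b := hlam.le.trans (hBl b hb)
    rcases le_total 0 x with h0 | h0
    · rw [abs_of_nonneg h0] at *
      refine ⟨b, Finset.mem_union_left _ hb, by rwa [abs_of_nonneg hb0], ?_⟩
      rw [abs_sub_comm, abs_of_nonneg] <;> linarith
    · rw [abs_of_nonpos h0] at *
      refine ⟨-b, Finset.mem_union_right _ (Finset.mem_image_of_mem _ hb),
        by rwa [abs_neg, abs_of_nonneg hb0], ?_⟩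
      rw [abs_of_nonneg] <;> linarith

/-- The vectors of `ℓ₁` norm at most `om` with entries in `A ∪ {0}`. -/
def sparseNet (p : ℕ) (A : Finset ℝ) (om : ℝ) : Finset (Fin p → ℝ) :=
  (Fintype.piFinset fun _ => insert 0 A).filter fun w => ∑ t, |w t| ≤ om

lemma mem_sparseNet {p : ℕ} {A : Finset ℝ} {om : ℝ} {w : Fin p → ℝ} :
    w ∈ sparseNet p A om ↔ (∀ t, w t = 0 ∨ w t ∈ A) ∧ ∑ t, |w t| ≤ om := by
  simp [sparseNet, Fintype.mem_piFinset]

lemma card_sparseNet_le {p : ℕ} {A : Finset ℝ} {lam om τ : ℝ} (hlam : 0 < lam)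
    (hA : ∀ a ∈ A, lam ≤ |a|) (hτ : 0 ≤ τ) (hpA : p * (A.card : ℝ) ≤ Real.exp τ) :
    ((sparseNet p A om).card : ℝ) ≤ Real.exp (1 + om / lam * τ) := by
  set c : ℝ → ℝ := fun a => if a = 0 then 1 else Real.exp (-τ) with hc
  have hc0 : ∀ a, 0 < c a := by
    intro a; simp only [hc]; split_ifs
    · exact one_pos
    · exact Real.exp_pos _
  have h0A : (0 : ℝ) ∉ A := fun h => by
    have := hA 0 h
    rw [abs_zero] at this
    linarith
  have h1 : ∀ w ∈ sparseNet p A om, 1 ≤ Real.exp (om / lam * τ) * ∏ t, c (w t) := by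
    intro w hw
    rw [mem_sparseNet] at hw
    have h2 : ∏ t, Real.exp (-(|w t| / lam * τ)) ≤ ∏ t, c (w t) := by
      refine Finset.prod_le_prod (fun _ _ => (Real.exp_pos _).le) fun t _ => ?_
      simp only [hc]
      split_ifs with h
      · simp [h]
      · have h3 := hA _ ((hw.1 t).resolve_left h)
        apply Real.exp_le_exp.2
        have : 1 ≤ |w t| / lam := (one_le_div hlam).2 h3
        nlinarith
    rw [← Real.exp_sum] at h2
    calc (1 : ℝ) ≤ Real.exp (om / lam * τ) * Real.exp (∑ t, -(|w t| / lam * τ)) := by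
          rw [← Real.exp_add]
          apply Real.one_le_exp
          rw [Finset.sum_neg_distrib, ← Finset.sum_mul, ← Finset.sum_div]
          have : (∑ t, |w t|) / lam ≤ om / lam := by gcongr; exact hw.2
          nlinarith
      _ ≤ _ := by gcongr
  have h2 : ∑ w ∈ Fintype.piFinset (fun _ : Fin p => insert 0 A), ∏ t, c (w t) ≤ Real.exp 1 := by
    rw [Finset.sum_prod_piFinset, Finset.prod_const, Finset.card_univ, Fintype.card_fin]
    rw [Finset.sum_insert h0A]
    have h3 : ∑ a ∈ A, c a = A.card * Real.exp (-τ) := by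
      rw [Finset.sum_congr rfl (g := fun _ => Real.exp (-τ))]
      · simp
      · intro a ha
        simp only [hc]
        rw [if_neg]
        rintro rfl
        exact h0A ha
    rw [h3]
    have h4 : c 0 + A.card * Real.exp (-τ) ≤ Real.exp (A.card * Real.exp (-τ)) := by
      have := Real.add_one_le_exp (A.card * Real.exp (-τ))
      simp only [hc, if_true]
      linarith
    have h5 : 0 ≤ c 0 + A.card * Real.exp (-τ) := by have := hc0 0; positivity
    refine (pow_le_pow_left₀ h5 h4 p).trans ?_
    rw [← Real.exp_nat_mul]
    apply Real.exp_le_exp.2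
    rw [← mul_assoc, Real.exp_neg, ← div_eq_mul_inv, div_le_one (Real.exp_pos _)]
    exact hpA
  calc ((sparseNet p A om).card : ℝ) = ∑ w ∈ sparseNet p A om, (1 : ℝ) := by simp
    _ ≤ ∑ w ∈ sparseNet p A om, Real.exp (om / lam * τ) * ∏ t, c (w t) := Finset.sum_le_sum h1
    _ ≤ ∑ w ∈ Fintype.piFinset (fun _ : Fin p => insert 0 A),
        Real.exp (om / lam * τ) * ∏ t, c (w t) := by
        refine Finset.sum_le_sum_of_subset_of_nonneg (Finset.filter_subset _ _) fun w _ _ => ?_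
        exact mul_nonneg (Real.exp_pos _).le (Finset.prod_nonneg fun t _ => (hc0 _).le)
    _ ≤ Real.exp (om / lam * τ) * Real.exp 1 := by
        rw [← Finset.mul_sum]
        gcongr
    _ = _ := by rw [← Real.exp_add, add_comm]

/-- Rounding the row of an admissible parameter to the net. -/
lemma exists_mem_sparseNet {p : ℕ} {A : Finset ℝ} {lam om h : ℝ} (hlam : 0 < lam)
    (hA : ∀ a ∈ A, lam ≤ |a|)
    (hA' : ∀ x : ℝ, lam ≤ |x| → |x| ≤ om → ∃ a ∈ A, |a| ≤ |x| ∧ |a - x| ≤ h)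
    (hh : 0 ≤ h) {z : Fin p → ℝ} (hz : ∑ t, |z t| ≤ om) (hz' : ∀ t, z t = 0 ∨ lam ≤ |z t|) :
    ∃ v ∈ sparseNet p A om, (∀ t, v t = 0 ↔ z t = 0) ∧ ∑ t, |v t - z t| ≤ om / lam * h := by
  have h1 : ∀ t, ∃ a : ℝ, (a = 0 ∨ a ∈ A) ∧ (a = 0 ↔ z t = 0) ∧ |a| ≤ |z t| ∧
      |a - z t| ≤ |z t| / lam * h := by
    intro t
    rcases hz' t with h0 | h0
    · exact ⟨0, Or.inl rfl, by simp [h0], by simp, by simp [h0]⟩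
    · have hle : |z t| ≤ om :=
        (Finset.single_le_sum (f := fun t => |z t|) (fun _ _ => abs_nonneg _)
          (Finset.mem_univ t)).trans hz
      obtain ⟨a, ha, ha1, ha2⟩ := hA' (z t) h0 hle
      have hane : a ≠ 0 := fun e => by
        have := hA a ha
        rw [e, abs_zero] at this
        linarith
      have hzne : z t ≠ 0 := fun e => by
        rw [e, abs_zero] at h0
        linarith
      refine ⟨a, Or.inr ha, by simp [hane, hzne], ha1, ha2.trans ?_⟩
      exact le_mul_of_one_le_left hh ((one_le_div hlam).2 h0)
  choose v hv1 hv2 hv3 hv4 using h1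
  refine ⟨v, mem_sparseNet.2 ⟨hv1, (Finset.sum_le_sum fun t _ => hv3 t).trans hz⟩, hv2, ?_⟩
  refine (Finset.sum_le_sum fun t _ => hv4 t).trans ?_
  rw [← Finset.sum_mul, ← Finset.sum_div]
  gcongr

/-- A family of neighbourhood estimators that is correct off an event controlled by a union bound
over pairs of a vertex and a wrong candidate vector. -/
lemma exists_decoder {p d n : ℕ} {lam om ε : ℝ} (hlam : 0 < lam) (hom0 : 0 ≤ om) (hε1 : ε ≤ 1)
    (W : Finset (Fin p → ℝ)) (hW0 : 0 ∈ W) (hW1 : ∀ w ∈ W, ∑ t, |w t| ≤ om)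
    (hW2 : ∀ w ∈ W, ∀ t, w t = 0 ∨ lam ≤ |w t|)
    (hW3 : ∀ z : Fin p → ℝ, ∑ t, |z t| ≤ om → (∀ t, z t = 0 ∨ lam ≤ |z t|) →
      ∃ v ∈ W, (∀ t, v t = 0 ↔ z t = 0) ∧ ∑ t, |v t - z t| ≤ ε) :
    ∃ φ : (Fin n → Fin p → Bool) → SimpleGraph (Fin p),
      (∀ xs, φ xs ∈ degClass p d) ∧
        ∀ G ∈ degClass p d, ∀ θ : Fin p → Fin p → ℝ, ParamClass G lam om θ →
          probn n θ (fun xs => φ xs ≠ G) ≤ p * W.card *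
            Real.exp (7 / 4 * ε ^ 2 - Real.sinh (lam / 2) ^ 2 / Real.exp (4 * om) / 8) ^ n := by
  have hmax : ∀ (xs : Fin n → Fin p → Bool) (s : Fin p), ∃ w ∈ W.filter (fun w => w s = 0),
      ∀ v ∈ W.filter (fun w => w s = 0),
        ∑ i, condLogLik s v (xs i) ≤ ∑ i, condLogLik s w (xs i) := fun xs s =>
    Finset.exists_max_image _ _ ⟨0, by simp [hW0]⟩
  choose est hest hestmax using hmax
  set dec : (Fin n → Fin p → Bool) → SimpleGraph (Fin p) := fun xs =>
    SimpleGraph.fromRel fun s t => est xs s t ≠ 0 with hdec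
  refine ⟨fun xs => if dec xs ∈ degClass p d then dec xs else ⊥, ?_, ?_⟩
  · intro xs
    dsimp only
    split_ifs with h
    · exact h
    · intro v; simp
  · rintro G hG θ ⟨hθ, hθ0, hθlam, hθom⟩
    have hrow : ∀ s t, θ s t = 0 ∨ lam ≤ |θ s t| := by
      intro s t
      by_cases h : G.Adj s t
      · exact Or.inr (hθlam s t h)
      · exact Or.inl (hθ0 s t h)
    have hadj : ∀ s t, G.Adj s t ↔ θ s t ≠ 0 := by
      intro s t
      refine ⟨fun h e => ?_, fun h => by_contra fun h' => h (hθ0 s t h')⟩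
      have := hθlam s t h
      rw [e, abs_zero] at this
      linarith
    have happrox := fun s => hW3 (θ s) (hθom s) (hrow s)
    choose v hvW hv0 hvε using happrox
    set J : Finset (Fin p × (Fin p → ℝ)) := (Finset.univ ×ˢ W).filter fun j =>
      j.2 j.1 = 0 ∧ ∃ t, ¬(j.2 t = 0 ↔ θ j.1 t = 0) with hJ
    have h1 := probn_le_sum_pow (n := n) θ
      (fun xs => (if dec xs ∈ degClass p d then dec xs else ⊥) ≠ G) J
      (fun j x => Real.exp ((condLogLik j.1 j.2 x - condLogLik j.1 (v j.1) x) / 2))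
      (fun _ _ => (Real.exp_pos _).le) ?_
    · refine h1.trans ?_
      have h2 : ∀ j ∈ J, (∑ x, isingP θ x *
          Real.exp ((condLogLik j.1 j.2 x - condLogLik j.1 (v j.1) x) / 2)) ^ n ≤
          Real.exp (7 / 4 * ε ^ 2 - Real.sinh (lam / 2) ^ 2 / Real.exp (4 * om) / 8) ^ n := by
        intro j hj
        obtain ⟨hjW, hj0, t, ht⟩ := Finset.mem_filter.1 hj
        have hjW' := (Finset.mem_product.1 hjW).2
        have hst : j.1 ≠ t := by
          rintro rfl
          exact ht (by simp [hj0, hθ.2])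
        have hgap : lam ≤ |j.2 t - θ j.1 t| := by
          rcases hW2 _ hjW' t with a | a <;> rcases hrow j.1 t with b | b
          · exact absurd (by simp [a, b]) ht
          · simpa [a] using b
          · simpa [b] using a
          · exfalso
            refine ht ⟨fun e => ?_, fun e => ?_⟩
            · rw [e, abs_zero] at a; linarith
            · rw [e, abs_zero] at b; linarith
        refine pow_le_pow_left₀ (Finset.sum_nonneg fun x _ =>
          mul_nonneg (isingP_nonneg _ _) (Real.exp_pos _).le) ?_ n
        exact sum_isingP_mul_exp_le hθ hom0 hlam.le hθom hst (hW1 _ hjW') hj0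
          ((hv0 _ _).2 (hθ.2 _)) hgap (hvε _) hε1
      refine (Finset.sum_le_sum h2).trans ?_
      rw [Finset.sum_const, nsmul_eq_mul]
      gcongr
      have hcard : J.card ≤ p * W.card :=
        (Finset.card_filter_le _ _).trans (by simp [Finset.card_product])
      exact_mod_cast hcard
    · intro xs hxs
      by_contra! hcon
      have hsupp : ∀ s t, est xs s t = 0 ↔ θ s t = 0 := by
        intro s
        by_contra hbad
        obtain ⟨hestW, hest0⟩ := Finset.mem_filter.1 (hest xs s)
        have hmem : (s, est xs s) ∈ J := by
          refine Finset.mem_filter.2 ⟨Finset.mem_product.2 ⟨Finset.mem_univ _, hestW⟩, hest0, ?_⟩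
          exact not_forall.1 hbad
        have h3 := hcon _ hmem
        rw [← Real.exp_sum, Real.exp_lt_one_iff, ← Finset.sum_div,
          Finset.sum_sub_distrib] at h3
        have h4 := hestmax xs s (v s) (Finset.mem_filter.2 ⟨hvW s, (hv0 s s).2 (hθ.2 s)⟩)
        linarith
      have hdecG : dec xs = G := by
        ext s t
        simp only [hdec, SimpleGraph.fromRel_adj, ne_eq, hsupp, hadj, hθ.1 t s, or_self]
        refine ⟨fun h => h.2, fun h => ⟨?_, h⟩⟩
        rintro rfl
        exact h (hθ.2 s)
      rw [hdecG] at hxs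
      exact hxs (if_pos hG)

/-- The sample-size condition makes the exponent dominate the size of the union bound. -/
lemma log_union_le {p n : ℕ} {lam om δ : ℝ} (hp : 2 ≤ p) (hlam : 0 < lam) (hle : lam ≤ om)
    (hδ : δ ∈ Set.Ioo (0 : ℝ) 1)
    (hn : (om * (3 * Real.exp (2 * om) + 1) / (Real.sinh (lam / 4)) ^ 2) ^ 2 *
        (16 * Real.log p + 4 * Real.log (2 / δ)) < (n : ℝ)) :
    Real.log p + (1 + om / lam * (Real.log p + 4 + 2 * (om / lam) + 2 * om)) + Real.log (1 / δ) ≤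
      n * (Real.sinh (lam / 2) ^ 2 / Real.exp (4 * om) / 16) := by
  obtain ⟨hδ0, hδ1⟩ := hδ
  have hom : 0 < om := hlam.trans_le hle
  set κ := om / lam with hκ
  have hκ1 : 1 ≤ κ := (one_le_div hlam).2 hle
  set S := Real.sinh (lam / 4) with hS
  set C := Real.cosh (lam / 4) with hC
  have hS0 : 0 < S := Real.sinh_pos_iff.2 (by linarith)
  have hC0 : 0 < C := Real.cosh_pos _
  have hSC : S ≤ lam / 2 * C := by
    have h1 := Real.add_one_le_exp (-(lam / 2))
    have h2 : Real.exp (-(lam / 4)) = Real.exp (lam / 4) * Real.exp (-(lam / 2)) := by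
      rw [← Real.exp_add]; congr 1; ring
    have h3 := Real.exp_pos (lam / 4)
    have h4 := Real.exp_pos (-(lam / 4))
    rw [hS, hC, Real.sinh_eq, Real.cosh_eq]
    nlinarith [mul_le_mul_of_nonneg_left h1 h3.le, mul_pos hlam h4]
  have hSC' : S ≤ C := (Real.sinh_lt_cosh _).le
  set M := (om * C / S) ^ 2 with hM
  have hq1 : om ≤ om * C / S := by
    rw [le_div_iff₀ hS0]; exact mul_le_mul_of_nonneg_left hSC' hom.le
  have hq2 : 2 * κ ≤ om * C / S := by
    rw [le_div_iff₀ hS0, hκ]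
    calc 2 * (om / lam) * S ≤ 2 * (om / lam) * (lam / 2 * C) := by gcongr
      _ = om * C := by field_simp
  set q := om * C / S with hq
  have hlogp : Real.log 2 ≤ Real.log p := Real.log_le_log two_pos (by exact_mod_cast hp)
  have hlog2 := Real.log_two_gt_d9
  set P := Real.log p with hP
  set T := Real.log (1 / δ) with hT
  have hT0 : 0 ≤ T := Real.log_nonneg (by rw [le_div_iff₀ hδ0]; linarith)
  have hT2 : T ≤ Real.log (2 / δ) := Real.log_le_log (by positivity) (by gcongr; norm_num)
  have hlow : 36 * M * (16 * P + 4 * T) ≤ n * (Real.sinh (lam / 2) ^ 2 / Real.exp (4 * om)) := by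
    have hs2 : Real.sinh (lam / 2) = 2 * S * C := by
      rw [hS, hC, ← Real.sinh_two_mul]; congr 1; ring
    have hE : Real.exp (4 * om) = Real.exp (2 * om) ^ 2 := by
      rw [← Real.exp_nat_mul]; congr 1; push_cast; ring
    rw [hs2, hE]
    set E := Real.exp (2 * om) with hEdef
    have hE0 : 0 < E := Real.exp_pos _
    have h1 : (om * (3 * E) / S ^ 2) ^ 2 * (16 * P + 4 * T) ≤ n := by
      refine le_trans ?_ hn.le
      gcongr
      linarith
    calc 36 * M * (16 * P + 4 * T)
        = (om * (3 * E) / S ^ 2) ^ 2 * (16 * P + 4 * T) * ((2 * S * C) ^ 2 / E ^ 2) := by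
          rw [hM, hq]; field_simp; ring
      _ ≤ _ := by gcongr
  have hMq : M = q ^ 2 := rfl
  have hq0 : 0 ≤ q := hom.le.trans hq1
  have hMκ : 4 * κ ^ 2 ≤ M := by
    calc 4 * κ ^ 2 = (2 * κ) ^ 2 := by ring
      _ ≤ q ^ 2 := by gcongr
  have hMo : 2 * (κ * om) ≤ M := by
    calc 2 * (κ * om) = (2 * κ) * om := by ring
      _ ≤ q * q := by gcongr
      _ = q ^ 2 := by ring
  have hκκ : κ ≤ κ ^ 2 := le_self_pow₀ hκ1 two_ne_zero
  have hM4 : 4 ≤ M := by linarith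
  have hP0 : 1 / 2 ≤ P := by linarith
  have hMP : M * (1 / 2) ≤ M * P := by gcongr
  have hκP : 4 * κ * P ≤ M * P := by gcongr; linarith
  have hP4 : 4 * P ≤ M * P := by gcongr
  have hMT : 4 * T ≤ M * T := by gcongr
  have e : n * (Real.sinh (lam / 2) ^ 2 / Real.exp (4 * om) / 16) =
      n * (Real.sinh (lam / 2) ^ 2 / Real.exp (4 * om)) / 16 := by ring
  rw [e]
  have e2 : κ * (P + 4 + 2 * κ + 2 * om) = κ * P + 4 * κ + 2 * κ ^ 2 + 2 * (κ * om) := by ring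
  have e3 : 36 * M * (16 * P + 4 * T) = 576 * (M * P) + 144 * (M * T) := by ring
  rw [e2]
  rw [e3] at hlow
  linarith

/-- Theorem 3(b) (Sufficient conditions for `G_{p,d}`, unknown edge weights): if the
sample size exceeds the stated threshold, some graph decoder succeeds with
probability at least `1 - δ` uniformly over all graphs in the class and all
admissible parameter vectors. -/
theorem sufficient_conditions_deg_unknown (p d n : ℕ) (lam om δ : ℝ)
    (hp : 2 ≤ p) (hd : 1 ≤ d) (hlam : 0 < lam) (hom : 0 < om)
    (hδ : δ ∈ Set.Ioo (0 : ℝ) 1)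
    (hn : (om * (3 * Real.exp (2 * om) + 1) / (Real.sinh (lam / 4)) ^ 2) ^ 2 *
        (16 * Real.log p + 4 * Real.log (2 / δ)) < (n : ℝ)) :
    ∃ φ : (Fin n → Fin p → Bool) → SimpleGraph (Fin p),
      (∀ xs, φ xs ∈ degClass p d) ∧
        ∀ G ∈ degClass p d, ∀ θ : Fin p → Fin p → ℝ, ParamClass G lam om θ →
          probn n θ (fun xs => φ xs ≠ G) ≤ δ := by
  rcases lt_or_ge om lam with hlt | hle
  · refine ⟨fun _ => ⊥, fun _ v => by simp, fun G _ θ hθ => ?_⟩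
    have hG : (⊥ : SimpleGraph (Fin p)) = G := by
      refine (eq_bot_iff.2 fun s t hst => ?_).symm
      have h1 := hθ.2.2.1 s t hst
      have h2 := Finset.single_le_sum (f := fun t => |θ s t|) (fun _ _ => abs_nonneg _)
        (Finset.mem_univ t)
      have h3 := hθ.2.2.2 s
      linarith
    simp [probn, hG, hδ.1.le]
  set E := Real.exp (2 * om) with hE
  have hE0 : 0 < E := Real.exp_pos _
  set κ := om / lam with hκ
  have hκ1 : 1 ≤ κ := (one_le_div hlam).2 hle
  set ε := lam / (11 * E) with hε
  set h := ε / κ with hh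
  have hh0 : 0 < h := by positivity
  obtain ⟨A, hAc, hAl, hAa⟩ := exists_grid (h := h) hlam hom.le hh0
  set τ := Real.log p + 4 + 2 * κ + 2 * om with hτ
  have hp0 : (0 : ℝ) < p := by positivity
  have hlogp : 0 ≤ Real.log p := Real.log_nonneg (by exact_mod_cast (by omega : 1 ≤ p))
  have hτ0 : 0 ≤ τ := by positivity
  have hE1 : 1 ≤ E := Real.one_le_exp (by positivity)
  have homE : om ≤ E := by have := Real.add_one_le_exp (2 * om); linarith
  have hpA : p * (A.card : ℝ) ≤ Real.exp τ := by
    have e1 : om / h = 11 * κ ^ 2 * E := by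
      rw [hh, hε, hκ]; field_simp
    have e2 : Real.exp τ = p * (Real.exp 4 * Real.exp κ ^ 2 * E) := by
      rw [hτ, Real.exp_add, Real.exp_add, Real.exp_add, Real.exp_log hp0, ← Real.exp_nat_mul]
      push_cast
      ring
    have e3 : (44 : ℝ) ≤ Real.exp 4 := by
      have h1 := Real.exp_one_gt_d9
      have h2 : Real.exp 4 = Real.exp 1 ^ 4 := by rw [← Real.exp_nat_mul]; norm_num
      rw [h2]
      calc (44 : ℝ) ≤ 2.7 ^ 4 := by norm_num
        _ ≤ _ := by gcongr; linarith
    have e4 : κ ≤ Real.exp κ := by have := Real.add_one_le_exp κ; linarith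
    rw [e2]
    refine mul_le_mul_of_nonneg_left (hAc.trans ?_) hp0.le
    rw [e1]
    have e5 : 1 ≤ κ ^ 2 * E := one_le_mul_of_one_le_of_one_le (one_le_pow₀ hκ1) hE1
    calc 2 * (11 * κ ^ 2 * E + 1) ≤ 44 * κ ^ 2 * E := by nlinarith
      _ ≤ Real.exp 4 * Real.exp κ ^ 2 * E := by gcongr
  have hcard := card_sparseNet_le (p := p) (om := om) hlam hAl hτ0 hpA
  have hκh : om / lam * h = ε := by rw [← hκ, hh]; field_simp
  have hε1 : ε ≤ 1 := by
    rw [hε, div_le_one (by positivity)]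
    linarith
  obtain ⟨φ, hφ, hφ'⟩ := exists_decoder (p := p) (d := d) (n := n) (lam := lam) (om := om) (ε := ε)
    hlam hom.le hε1 (sparseNet p A om)
    (mem_sparseNet.2 ⟨fun _ => Or.inl rfl, by simpa using hom.le⟩)
    (fun w hw => (mem_sparseNet.1 hw).2)
    (fun w hw t => ((mem_sparseNet.1 hw).1 t).imp_right (hAl _))
    (fun z hz hz' => by
      have := exists_mem_sparseNet hlam hAl hAa hh0.le hz hz'
      rwa [hκh] at this)
  refine ⟨φ, hφ, fun G hG θ hθ => (hφ' G hG θ hθ).trans ?_⟩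
  have hexp : 7 / 4 * ε ^ 2 - Real.sinh (lam / 2) ^ 2 / Real.exp (4 * om) / 8 ≤
      -(Real.sinh (lam / 2) ^ 2 / Real.exp (4 * om) / 16) := by
    have e1 : Real.exp (4 * om) = E ^ 2 := by
      rw [← Real.exp_nat_mul]; congr 1; push_cast; ring
    have e2 : lam / 2 ≤ Real.sinh (lam / 2) := Real.self_le_sinh_iff.2 (by linarith)
    have e3 : (lam / 2) ^ 2 ≤ Real.sinh (lam / 2) ^ 2 := by gcongr
    have e4 : ε ^ 2 = lam ^ 2 / E ^ 2 / 121 := by rw [hε]; field_simp; norm_num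
    have e5 : (lam / 2) ^ 2 / E ^ 2 ≤ Real.sinh (lam / 2) ^ 2 / E ^ 2 := by gcongr
    have e6 : (lam / 2) ^ 2 / E ^ 2 = lam ^ 2 / E ^ 2 / 4 := by ring
    have e7 : 0 ≤ lam ^ 2 / E ^ 2 := by positivity
    rw [e1, e4]
    linarith
  have hnum := log_union_le hp hlam hle hδ hn
  rw [← hκ, ← hτ] at hnum
  set r := Real.sinh (lam / 2) ^ 2 / Real.exp (4 * om) / 16 with hr
  calc (p : ℝ) * (sparseNet p A om).card *
        Real.exp (7 / 4 * ε ^ 2 - Real.sinh (lam / 2) ^ 2 / Real.exp (4 * om) / 8) ^ n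
      ≤ Real.exp (Real.log p) * Real.exp (1 + κ * τ) * Real.exp (-r) ^ n := by
        rw [Real.exp_log hp0]
        gcongr
    _ = Real.exp (Real.log p + (1 + κ * τ) - n * r) := by
        rw [← Real.exp_nat_mul, ← Real.exp_add, ← Real.exp_add]
        congr 1; ring
    _ ≤ Real.exp (-Real.log (1 / δ)) := Real.exp_le_exp.2 (by linarith)
    _ = δ := by
        rw [one_div, Real.log_inv, neg_neg, Real.exp_log hδ.1]
end
end
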